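/- Let n ≥ 3 and u be a bounded harmonic function on the open unit ball B^n ⊂ ℝ^n. Then for every x ∈ B^n, |∇u(x)| ≤ (c_n/(1-|x|²)) · [∫_{-1}^{1} |t - ((n-2)/n)|x|| (1-t²)^{(n-3)/2} / (1-2t|x|+|x|²)^{(n-2)/2} dt] · sup_{y∈B^n}|u(y)|, where c_n = 2Γ((n+2)/2)/(Γ(1/2)Γ((n-1)/2)). -/

import Mathlib

open scoped Real BigOperators

/-- Pochhammer symbol `(lam)_m`. -/
noncomputable def poch (lam : ℝ) (m : ℕ) : ℝ := (ascPochhammer ℝ m).eval lam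

/-- Gegenbauer polynomial `C_k^lam(x)`, via its explicit representation. -/
noncomputable def gegen (lam : ℝ) (k : ℕ) (x : ℝ) : ℝ :=
  ∑ j ∈ Finset.range (k / 2 + 1),
    (-1 : ℝ) ^ j * poch lam (k - j) / ((Nat.factorial j : ℝ) * (Nat.factorial (k - 2 * j) : ℝ))
      * (2 * x) ^ (k - 2 * j)

/-- `u` is harmonic on the open unit ball of `ℝⁿ`: twice continuously differentiable
with vanishing Laplacian. -/
def IsHarmonicOnBall (n : ℕ) (u : EuclideanSpace ℝ (Fin n) → ℝ) : Prop :=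
  ContDiffOn ℝ 2 u (Metric.ball 0 1) ∧
  ∀ x ∈ Metric.ball (0 : EuclideanSpace ℝ (Fin n)) 1,
    ∑ i : Fin n, iteratedFDeriv ℝ 2 u x
      ![EuclideanSpace.single i 1, EuclideanSpace.single i 1] = 0

/-- The sup of `|u|` over the open unit ball. -/
noncomputable def supAbs (n : ℕ) (u : EuclideanSpace ℝ (Fin n) → ℝ) : ℝ :=
  ⨆ y : Metric.ball (0 : EuclideanSpace ℝ (Fin n)) 1, |u y.1|

open Set Filter Topology MeasureTheory Metric
open scoped ENNReal

/-- The angular density profile, in hyperbolic coordinates. -/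
noncomputable def hypProfile (lam γ t : ℝ) : ℝ :=
  Real.exp (-(lam + 2) * t) * (Real.cosh t - γ * Real.sinh t) ^ (-lam) / Real.cosh t

/-- The logarithmic derivative of `hypProfile`. -/
noncomputable def hypProfileLogDeriv (lam γ t : ℝ) : ℝ :=
  -(lam + 2) + lam * (γ * Real.cosh t - Real.sinh t) / (Real.cosh t - γ * Real.sinh t)
    - Real.sinh t / Real.cosh t

lemma hypProfile_pos {lam γ t : ℝ} (ht : 0 < Real.cosh t - γ * Real.sinh t) :
    0 < hypProfile lam γ t := by
  have := Real.cosh_pos t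
  unfold hypProfile
  positivity

lemma hasDerivAt_hypProfile {lam γ t : ℝ} (ht : 0 < Real.cosh t - γ * Real.sinh t) :
    HasDerivAt (hypProfile lam γ) (hypProfile lam γ t * hypProfileLogDeriv lam γ t) t := by
  have hc := Real.cosh_pos t
  have h1 : HasDerivAt (fun t : ℝ => Real.exp (-(lam + 2) * t))
      (Real.exp (-(lam + 2) * t) * (-(lam + 2))) t := by
    simpa using ((hasDerivAt_id t).const_mul (-(lam + 2))).exp
  have h2 : HasDerivAt (fun t : ℝ => Real.cosh t - γ * Real.sinh t)
      (Real.sinh t - γ * Real.cosh t) t :=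
    (Real.hasDerivAt_cosh t).sub ((Real.hasDerivAt_sinh t).const_mul γ)
  have h3 := h2.rpow_const (p := -lam) (Or.inl ht.ne')
  have h4 := (h1.mul h3).div (Real.hasDerivAt_cosh t) hc.ne'
  refine h4.congr_deriv ?_
  have e : (Real.cosh t - γ * Real.sinh t) ^ (-lam - 1)
      = (Real.cosh t - γ * Real.sinh t) ^ (-lam) / (Real.cosh t - γ * Real.sinh t) := by
    rw [Real.rpow_sub_one ht.ne']
  simp only [hypProfile, hypProfileLogDeriv, Pi.mul_apply]
  rw [e]
  field_simp
  ring

lemma hypProfileLogDeriv_eq {lam γ t : ℝ} (ht : 0 < Real.cosh t - γ * Real.sinh t) :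
    hypProfileLogDeriv lam γ t = -(lam + 2 - lam * γ) + Real.tanh t *
      (lam * (γ ^ 2 - 1) / (1 - γ * Real.tanh t) - 1) := by
  have hc := Real.cosh_pos t
  rw [Real.tanh_eq_sinh_div_cosh]
  have : 1 - γ * (Real.sinh t / Real.cosh t) = (Real.cosh t - γ * Real.sinh t) / Real.cosh t := by
    field_simp
  rw [this]
  unfold hypProfileLogDeriv
  field_simp
  ring

lemma cosh_sub_mul_sinh_pos_of_le {γ s t : ℝ} (hγ : 0 ≤ γ) (hst : s ≤ t)
    (ht : 0 < Real.cosh t - γ * Real.sinh t) : 0 < Real.cosh s - γ * Real.sinh s := by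
  have hcs := Real.cosh_pos s
  have hct := Real.cosh_pos t
  have h1 : Real.sinh s * Real.cosh t ≤ Real.sinh t * Real.cosh s := by
    have := Real.sinh_nonneg_iff.2 (sub_nonneg.2 hst)
    rw [Real.sinh_sub] at this
    linarith
  have h2 : 0 < (Real.cosh s - γ * Real.sinh s) * Real.cosh t := by
    nlinarith [mul_le_mul_of_nonneg_left h1 hγ, mul_pos ht hcs]
  exact pos_of_mul_pos_left h2 hct.le

lemma tanh_mono {s t : ℝ} (hst : s ≤ t) : Real.tanh s ≤ Real.tanh t := by
  have hcs := Real.cosh_pos s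
  have hct := Real.cosh_pos t
  rw [Real.tanh_eq_sinh_div_cosh, Real.tanh_eq_sinh_div_cosh, div_le_div_iff₀ hcs hct]
  have := Real.sinh_nonneg_iff.2 (sub_nonneg.2 hst)
  rw [Real.sinh_sub] at this
  linarith

lemma mul_tanh_lt_one {γ t : ℝ} (ht : 0 < Real.cosh t - γ * Real.sinh t) :
    γ * Real.tanh t < 1 := by
  have hc := Real.cosh_pos t
  rw [Real.tanh_eq_sinh_div_cosh, ← mul_div_assoc, div_lt_one hc]
  linarith

/-- The symmetrization of `hypProfile` is increasing on the positive half of its domain. -/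
lemma hypProfile_add_neg_mono {lam γ : ℝ} (hlam : 0 < lam) (h1 : lam + 1 ≤ lam * γ)
    (h2 : lam * γ ≤ lam + 2) {s t : ℝ} (hs : 0 ≤ s) (hst : s ≤ t)
    (ht : 0 < Real.cosh t - γ * Real.sinh t) :
    hypProfile lam γ s + hypProfile lam γ (-s) ≤ hypProfile lam γ t + hypProfile lam γ (-t) := by
  have hγ : 1 < γ := by
    by_contra h
    push Not at h
    nlinarith
  have hN : 2 ≤ lam * (γ ^ 2 - 1) := by
    have : 0 ≤ (lam * γ - (lam + 1)) * (lam * γ + (lam + 1)) := by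
      apply mul_nonneg <;> nlinarith
    have h3 : lam * 2 ≤ lam * (lam * (γ ^ 2 - 1)) := by nlinarith
    exact le_of_mul_le_mul_left h3 hlam
  set N := lam * (γ ^ 2 - 1) with hNdef
  set ε := lam + 2 - lam * γ with hε
  have hε0 : 0 ≤ ε := by linarith
  have hpos : ∀ r ∈ Icc 0 t, 0 < Real.cosh r - γ * Real.sinh r := fun r hr =>
    cosh_sub_mul_sinh_pos_of_le (by linarith) hr.2 ht
  have hneg : ∀ r ∈ Icc 0 t, 0 < Real.cosh (-r) - γ * Real.sinh (-r) := fun r hr =>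
    cosh_sub_mul_sinh_pos_of_le (by linarith) (by linarith [hr.1]) (hpos r hr)
  have hU : ∀ r ∈ Icc 0 t, hypProfileLogDeriv lam γ r
      = -ε + Real.tanh r * (N / (1 - γ * Real.tanh r) - 1) := fun r hr =>
    hypProfileLogDeriv_eq (hpos r hr)
  have hV : ∀ r ∈ Icc 0 t, hypProfileLogDeriv lam γ (-r)
      = -ε - Real.tanh r * (N / (1 + γ * Real.tanh r) - 1) := fun r hr => by
    rw [hypProfileLogDeriv_eq (hneg r hr), Real.tanh_neg, mul_neg, sub_neg_eq_add, ← hNdef, ← hε]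
    ring
  have hT0 : ∀ r ∈ Icc 0 t, 0 ≤ Real.tanh r := fun r hr => by
    simpa using tanh_mono hr.1
  have hz1 : ∀ r ∈ Icc 0 t, γ * Real.tanh r < 1 := fun r hr => mul_tanh_lt_one (hpos r hr)
  have hd : ∀ r ∈ Icc 0 t, HasDerivAt (fun r => hypProfile lam γ (-r))
      (-(hypProfile lam γ (-r) * hypProfileLogDeriv lam γ (-r))) r := fun r hr => by
    have := (hasDerivAt_hypProfile (lam := lam) (hneg r hr)).comp r (hasDerivAt_neg r)
    exact this.congr_deriv (by ring)
  have hUmono : ∀ r ∈ Icc 0 t, ∀ q ∈ Icc 0 r,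
      hypProfileLogDeriv lam γ q ≤ hypProfileLogDeriv lam γ r := fun r hr q hq => by
    have hq' : q ∈ Icc 0 t := ⟨hq.1, hq.2.trans hr.2⟩
    rw [hU r hr, hU q hq']
    have a1 := hT0 q hq'
    have a2 := tanh_mono hq.2
    have a3 := hz1 r hr
    have a4 : N / (1 - γ * Real.tanh q) ≤ N / (1 - γ * Real.tanh r) := by
      apply div_le_div_of_nonneg_left (by linarith) (by linarith)
      nlinarith
    have a5 : 2 ≤ N / (1 - γ * Real.tanh q) := by
      rw [le_div_iff₀ (by linarith [hz1 q hq'])]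
      nlinarith
    nlinarith
  have hmain : ∀ r ∈ Icc 0 t, 0 ≤ hypProfile lam γ r * hypProfileLogDeriv lam γ r
      + -(hypProfile lam γ (-r) * hypProfileLogDeriv lam γ (-r)) := fun r hr => by
    have p0 := hypProfile_pos (lam := lam) (hpos r hr)
    have q0 := hypProfile_pos (lam := lam) (hneg r hr)
    have T0 := hT0 r hr
    have z1 := hz1 r hr
    have z0 : 0 ≤ γ * Real.tanh r := by positivity
    have hVn : hypProfileLogDeriv lam γ (-r) ≤ 0 := by
      rw [hV r hr]
      have : 1 ≤ N / (1 + γ * Real.tanh r) := by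
        rw [le_div_iff₀ (by linarith)]
        linarith
      nlinarith
    rcases le_or_gt 0 (hypProfileLogDeriv lam γ r) with hu | hu
    · nlinarith [mul_nonneg p0.le hu, mul_nonneg q0.le (neg_nonneg.2 hVn)]
    · have hpq : hypProfile lam γ r ≤ hypProfile lam γ (-r) := by
        have hm : MonotoneOn (fun r => Real.log (hypProfile lam γ (-r))
            - Real.log (hypProfile lam γ r)) (Icc 0 r) := by
          have hder : ∀ q ∈ Icc 0 r, HasDerivAt (fun r => Real.log (hypProfile lam γ (-r))
              - Real.log (hypProfile lam γ r))
              (-hypProfileLogDeriv lam γ (-q) - hypProfileLogDeriv lam γ q) q := fun q hq => by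
            have hq' : q ∈ Icc 0 t := ⟨hq.1, hq.2.trans hr.2⟩
            have p0 := hypProfile_pos (lam := lam) (hpos q hq')
            have q0 := hypProfile_pos (lam := lam) (hneg q hq')
            refine (((hd q hq').log q0.ne').sub
              ((hasDerivAt_hypProfile (hpos q hq')).log p0.ne')).congr_deriv ?_
            field_simp
          apply monotoneOn_of_deriv_nonneg (convex_Icc 0 r)
          · exact fun q hq => (hder q hq).continuousAt.continuousWithinAt
          · exact fun q hq => (hder q (interior_subset hq)).differentiableAt.differentiableWithinAt
          · intro q hq
            have hq := interior_subset hq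
            have hq' : q ∈ Icc 0 t := ⟨hq.1, hq.2.trans hr.2⟩
            rw [(hder q hq).deriv]
            have hu' := (hUmono r hr q hq).trans_lt hu
            rw [hU q hq'] at hu' ⊢
            rw [hV q hq']
            have T0 := hT0 q hq'
            have z1 := hz1 q hq'
            have z0 : 0 ≤ γ * Real.tanh q := by positivity
            set T := Real.tanh q
            set z := γ * T
            have b1 : 2 ≤ N / (1 - z) := by
              rw [le_div_iff₀ (by linarith)]
              nlinarith
            have b2 : T * (N / (1 + z)) = T * (N / (1 - z)) - 2 * z / (1 + z) * (T * (N / (1 - z))) := by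
              have : 1 - z ≠ 0 := by linarith
              have : 1 + z ≠ 0 := by linarith
              field_simp
              ring
            have b3 : T * (N / (1 - z)) ≤ 2 * ε := by nlinarith
            have b4 : 2 * z / (1 + z) ≤ 1 := by
              rw [div_le_one (by linarith)]
              linarith
            have b5 : 0 ≤ T * (N / (1 - z)) := by positivity
            nlinarith
        have := hm ⟨le_rfl, hr.1⟩ ⟨hr.1, le_rfl⟩ hr.1
        simp only [neg_zero, sub_self] at this
        exact (Real.log_le_log_iff p0 q0).1 (by linarith)
      have hsum : hypProfileLogDeriv lam γ (-r) ≤ hypProfileLogDeriv lam γ r := by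
        rw [hU r hr, hV r hr]
        have c1 : 2 ≤ N / (1 - γ * Real.tanh r) := by
          rw [le_div_iff₀ (by linarith)]
          nlinarith
        have c2 : 1 ≤ N / (1 + γ * Real.tanh r) := by
          rw [le_div_iff₀ (by linarith)]
          linarith
        nlinarith
      nlinarith
  have hmono : MonotoneOn (fun r => hypProfile lam γ r + hypProfile lam γ (-r)) (Icc 0 t) := by
    have hder : ∀ r ∈ Icc 0 t, HasDerivAt (fun r => hypProfile lam γ r + hypProfile lam γ (-r))
        (hypProfile lam γ r * hypProfileLogDeriv lam γ r
          + -(hypProfile lam γ (-r) * hypProfileLogDeriv lam γ (-r))) r := fun r hr =>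
      (hasDerivAt_hypProfile (hpos r hr)).add (hd r hr)
    apply monotoneOn_of_deriv_nonneg (convex_Icc 0 t)
    · exact fun q hq => (hder q hq).continuousAt.continuousWithinAt
    · exact fun q hq => (hder q (interior_subset hq)).differentiableAt.differentiableWithinAt
    · intro q hq
      rw [(hder q (interior_subset hq)).deriv]
      exact hmain q (interior_subset hq)
  exact hmono ⟨hs, hst⟩ ⟨hs.trans hst, le_rfl⟩ hst

section Polar

variable {E : Type*} [NormedAddCommGroup E] [NormedSpace ℝ E] [FiniteDimensional ℝ E]
  [MeasurableSpace E] [BorelSpace E] [Nontrivial E] (μ : Measure E) [μ.IsAddHaarMeasure]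

/-- Integration in polar coordinates, for nonnegative functions. -/
lemma lintegral_eq_lintegral_toSphere {f : E → ENNReal} (hf : Measurable f) :
    ∫⁻ z, f z ∂μ = ∫⁻ η, (∫⁻ s in Ioi (0 : ℝ),
      ENNReal.ofReal (s ^ (Module.finrank ℝ E - 1)) * f (s • (η : E))) ∂μ.toSphere := by
  have hm : Measurable fun p : sphere (0 : E) 1 × Ioi (0 : ℝ) => f (p.2.1 • p.1.1) :=
    hf.comp (by fun_prop)
  calc ∫⁻ z, f z ∂μ = ∫⁻ z : ({0}ᶜ : Set E), f z ∂(μ.comap (↑)) := by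
        rw [lintegral_subtype_comap (measurableSet_singleton _).compl,
          restrict_compl_singleton]
    _ = ∫⁻ p, f (p.2.1 • p.1.1) ∂(μ.toSphere.prod (.volumeIoiPow (Module.finrank ℝ E - 1))) := by
        rw [← (μ.measurePreserving_homeomorphUnitSphereProd).lintegral_comp hm]
        refine lintegral_congr fun z => ?_
        have : (z : E) ≠ 0 := z.2
        simp [smul_smul, this]
    _ = ∫⁻ η, ∫⁻ s, f (s.1 • η.1) ∂(.volumeIoiPow (Module.finrank ℝ E - 1)) ∂μ.toSphere :=
        lintegral_prod _ hm.aemeasurable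
    _ = _ := by
        refine lintegral_congr fun η => ?_
        rw [Measure.volumeIoiPow, lintegral_withDensity_eq_lintegral_mul]
        · rw [← lintegral_subtype_comap measurableSet_Ioi]
          rfl
        · fun_prop
        · exact hf.comp (by fun_prop)

/-- Integration in polar coordinates. -/
lemma integral_eq_integral_toSphere {f : E → ℝ} (hf : Integrable f μ) :
    ∫ z, f z ∂μ = ∫ s in Ioi (0 : ℝ),
      s ^ (Module.finrank ℝ E - 1) * ∫ η, f (s • (η : E)) ∂μ.toSphere := by
  have hmp := (μ.measurePreserving_homeomorphUnitSphereProd)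
  have hme := (homeomorphUnitSphereProd E).measurableEmbedding
  have hcomp : (fun z : ({0}ᶜ : Set E) => f z) =
      (fun p : sphere (0 : E) 1 × Ioi (0 : ℝ) => f (p.2.1 • p.1.1)) ∘
        homeomorphUnitSphereProd E := by
    ext z
    have : (z : E) ≠ 0 := z.2
    simp [smul_smul, this]
  have hint : Integrable (fun p : sphere (0 : E) 1 × Ioi (0 : ℝ) => f (p.2.1 • p.1.1))
      (μ.toSphere.prod (.volumeIoiPow (Module.finrank ℝ E - 1))) := by
    rw [← hmp.integrable_comp_emb hme, ← hcomp]
    exact (integrableOn_iff_comap_subtypeVal (measurableSet_singleton _).compl).1 hf.integrableOn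
  calc ∫ z, f z ∂μ = ∫ z : ({0}ᶜ : Set E), f z ∂(μ.comap (↑)) := by
        rw [integral_subtype_comap (measurableSet_singleton _).compl fun x ↦ f x,
          restrict_compl_singleton]
    _ = ∫ p, f (p.2.1 • p.1.1) ∂(μ.toSphere.prod (.volumeIoiPow (Module.finrank ℝ E - 1))) := by
        rw [← hmp.integral_comp hme, hcomp]
        rfl
    _ = ∫ s, ∫ η, f (s.1 • η.1) ∂μ.toSphere ∂(.volumeIoiPow (Module.finrank ℝ E - 1)) :=
        integral_prod_symm _ hint
    _ = _ := by
        simp only [Measure.volumeIoiPow, ENNReal.ofReal]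
        rw [integral_withDensity_eq_integral_smul]
        · rw [integral_subtype_comap measurableSet_Ioi fun a ↦
            Real.toNNReal (a ^ (Module.finrank ℝ E - 1)) • ∫ η, f (a • η.1) ∂μ.toSphere]
          refine setIntegral_congr_fun measurableSet_Ioi fun x hx ↦ ?_
          simp only [NNReal.smul_def, smul_eq_mul, Real.coe_toNNReal _ (pow_nonneg (le_of_lt hx) _)]
        · exact (measurable_subtype_coe.pow_const _).real_toNNReal

end Polar

section Flux

variable {n : ℕ}

local notation "𝔼" => EuclideanSpace ℝ (Fin n)

/-- A field which is divergence free on a ball has no flux against any radial weight. -/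
lemma integral_radial_mul_inner_eq_zero {Y : 𝔼 → 𝔼}
    (hY : ContDiff ℝ 1 Y) {R : ℝ} (hR : 0 ≤ R)
    (hdiv : ∀ z ∈ ball (0 : 𝔼) R,
      ∑ i, (fderiv ℝ Y z (EuclideanSpace.single i 1)) i = 0)
    {g : ℝ → ℝ} (hg : Continuous g) (hgR : ∀ s, R ≤ s → g s = 0) :
    ∫ z, g ‖z‖ * inner ℝ (Y z) z = 0 := by
  have hgs : Continuous fun s => g (√s) := hg.comp Real.continuous_sqrt
  set P : ℝ → ℝ := fun τ => ∫ s in (R ^ 2)..τ, g (√s) with hP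
  have hPd : ∀ τ, HasDerivAt P (g (√τ)) τ := fun τ =>
    intervalIntegral.integral_hasDerivAt_right (hgs.intervalIntegrable _ _)
      (hgs.stronglyMeasurableAtFilter _ _) hgs.continuousAt
  have hP0 : ∀ τ, R ^ 2 ≤ τ → P τ = 0 := fun τ hτ => by
    rw [hP]
    refine (intervalIntegral.integral_congr (g := fun _ => (0 : ℝ)) fun s hs => ?_).trans
      intervalIntegral.integral_zero
    rw [uIcc_of_le hτ] at hs
    exact hgR _ (Real.le_sqrt_of_sq_le hs.1)
  set X : 𝔼 → ℝ := fun z => P (‖z‖ ^ 2) with hX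
  have hXd : ∀ z, HasFDerivAt X (g ‖z‖ • ((2 : ℝ) • innerSL ℝ z)) z := fun z => by
    have h1 : HasFDerivAt (fun z : 𝔼 => ‖z‖ ^ 2) ((2 : ℝ) • innerSL ℝ z) z := by
      have := (hasStrictFDerivAt_norm_sq z).hasFDerivAt
      refine this.congr_fderiv ?_
      ext; simp
    have := (hPd (‖z‖ ^ 2)).comp_hasFDerivAt z h1
    rwa [Real.sqrt_sq (norm_nonneg z)] at this
  have hXf : ∀ z m, fderiv ℝ X z m = 2 * g ‖z‖ * inner ℝ z m := fun z m => by
    rw [(hXd z).fderiv]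
    simp
    ring
  have hXc : Continuous X := continuous_iff_continuousAt.2 fun z => (hXd z).continuousAt
  have hXs : HasCompactSupport X := by
    refine HasCompactSupport.of_support_subset_isCompact (isCompact_closedBall (0 : 𝔼) R) fun z hz => ?_
    by_contra h
    refine hz (hP0 _ ?_)
    rw [mem_closedBall_zero_iff, not_le] at h
    gcongr
  have hYi : ∀ i z, HasFDerivAt (fun z => Y z i)
      ((EuclideanSpace.proj i : 𝔼 →L[ℝ] ℝ).comp (fderiv ℝ Y z)) z := fun i z =>
    ((EuclideanSpace.proj i : 𝔼 →L[ℝ] ℝ).hasFDerivAt).comp z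
      (hY.differentiable one_ne_zero z).hasFDerivAt
  have hYc : ∀ i, Continuous fun z => Y z i := fun i =>
    continuous_iff_continuousAt.2 fun z => (hYi i z).continuousAt
  have hY' : Continuous fun z => fderiv ℝ Y z := hY.continuous_fderiv one_ne_zero
  have hYd : ∀ i z m, fderiv ℝ (fun z => Y z i) z m = (fderiv ℝ Y z m) i := fun i z m => by
    rw [(hYi i z).fderiv]
    simp
  have hYdc : ∀ i m, Continuous fun z => (fderiv ℝ Y z m) i := fun i m =>
    (EuclideanSpace.proj i : 𝔼 →L[ℝ] ℝ).continuous.comp (hY'.clm_apply continuous_const)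
  have hX'c : ∀ m, Continuous fun z => fderiv ℝ X z m := fun m => by
    simp only [hXf]
    fun_prop
  have hX's : ∀ m, HasCompactSupport fun z => fderiv ℝ X z m := fun m => by
    exact hXs.fderiv_apply (𝕜 := ℝ) m
  have ibp : ∀ i, ∫ z, X z * (fderiv ℝ Y z (EuclideanSpace.single i 1)) i
      = -∫ z, fderiv ℝ X z (EuclideanSpace.single i 1) * Y z i := fun i => by
    simp only [← hYd]
    refine integral_mul_fderiv_eq_neg_fderiv_mul_of_integrable ?_ ?_ ?_ ?_ ?_
    · exact ((hX'c _).mul (hYc i)).integrable_of_hasCompactSupport (hX's _).mul_right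
    · simp only [hYd]
      exact (hXc.mul (hYdc i _)).integrable_of_hasCompactSupport hXs.mul_right
    · exact (hXc.mul (hYc i)).integrable_of_hasCompactSupport hXs.mul_right
    · exact fun z _ => (hXd z).differentiableAt
    · exact fun z _ => (hYi i z).differentiableAt
  have hsum : ∫ z, X z * ∑ i, (fderiv ℝ Y z (EuclideanSpace.single i 1)) i
      = -∫ z, ∑ i, fderiv ℝ X z (EuclideanSpace.single i 1) * Y z i := by
    simp only [Finset.mul_sum]
    rw [integral_finsetSum, integral_finsetSum, ← Finset.sum_neg_distrib]
    · exact Finset.sum_congr rfl fun i _ => ibp i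
    · exact fun i _ =>
        ((hX'c _).mul (hYc i)).integrable_of_hasCompactSupport (hX's _).mul_right
    · exact fun i _ => (hXc.mul (hYdc i _)).integrable_of_hasCompactSupport hXs.mul_right
  have hleft : ∫ z, X z * ∑ i, (fderiv ℝ Y z (EuclideanSpace.single i 1)) i = 0 := by
    rw [← integral_zero 𝔼 ℝ]
    congr 1 with z
    by_cases hz : z ∈ ball (0 : 𝔼) R
    · rw [hdiv z hz, mul_zero]
    · rw [mem_ball_zero_iff, not_lt] at hz
      have : X z = 0 := hP0 _ (by gcongr)
      rw [this, zero_mul]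
  rw [hleft, zero_eq_neg] at hsum
  have : (fun z => ∑ i, fderiv ℝ X z (EuclideanSpace.single i 1) * Y z i)
      = fun z => 2 * (g ‖z‖ * inner ℝ (Y z) z) := by
    ext z
    simp only [hXf, PiLp.inner_apply, Finset.mul_sum]
    refine Finset.sum_congr rfl fun i _ => ?_
    simp
    ring
  rw [this, integral_const_mul] at hsum
  linarith

/-- A field which is divergence free on a ball has no flux through concentric spheres. -/
lemma integral_sphere_inner_eq_zero [NeZero n]
    {Y : 𝔼 → 𝔼}
    (hY : ContDiff ℝ 1 Y) {R : ℝ}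
    (hdiv : ∀ z ∈ ball (0 : 𝔼) R,
      ∑ i, (fderiv ℝ Y z (EuclideanSpace.single i 1)) i = 0)
    {ρ : ℝ} (hρ : 0 < ρ) (hρR : ρ < R) :
    ∫ η : sphere (0 : 𝔼) 1, inner ℝ (Y (ρ • (η : 𝔼)))
      (η : 𝔼) ∂(volume : Measure (𝔼)).toSphere = 0 := by
  set A : ℝ → ℝ := fun s => ∫ η : sphere (0 : 𝔼) 1, inner ℝ (Y (s • (η : 𝔼)))
      (η : 𝔼) ∂(volume : Measure 𝔼).toSphere with hA
  have hYc := hY.continuous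
  have hAc : Continuous A := by
    have hc : Continuous (Function.uncurry fun (s : ℝ) (η : sphere (0 : 𝔼) 1) =>
        (inner ℝ (Y (s • (η : 𝔼))) (η : 𝔼) : ℝ)) := by
      simp only [Function.uncurry_def]
      fun_prop
    have := continuous_parametric_integral_of_continuous
      (μ := (volume : Measure 𝔼).toSphere) hc isCompact_univ
    simpa only [Measure.restrict_univ] using this
  set f : ℝ → ℝ := fun s => s ^ (Module.finrank ℝ 𝔼 - 1) * (s * A s) with hf
  have hfc : Continuous f := by fun_prop
  have key := isOpen_Ioo.ae_eq_zero_of_integral_contDiff_smul_eq_zero (U := Ioo 0 R) (f := f)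
    (μ := volume) (hfc.locallyIntegrable.locallyIntegrableOn _) (fun g hg hgs hgU => by
      have hg0 : ∀ s, s ∉ Ioo 0 R → g s = 0 := fun s hs =>
        image_eq_zero_of_notMem_tsupport fun h => hs (hgU h)
      have h0 := integral_radial_mul_inner_eq_zero hY (hρ.trans hρR).le hdiv hg.continuous
        (fun s hs => hg0 s fun h => absurd h.2 hs.not_gt)
      rw [integral_eq_integral_toSphere] at h0
      · rw [← h0, ← integral_indicator measurableSet_Ioi]
        congr 1 with s
        by_cases hs : 0 < s
        · rw [indicator_of_mem (mem_Ioi.2 hs), smul_eq_mul, hf]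
          have : ∀ η : sphere (0 : 𝔼) 1, g ‖s • (η : 𝔼)‖ * inner ℝ (Y (s • (η : 𝔼))) (s • (η : 𝔼))
              = (g s * s) * inner ℝ (Y (s • (η : 𝔼))) (η : 𝔼) := fun η => by
            rw [norm_smul, norm_eq_of_mem_sphere, mul_one, Real.norm_of_nonneg hs.le,
              inner_smul_right]
            ring
          simp only [this, integral_const_mul, hA]
          ring
        · rw [indicator_of_notMem (by simpa using hs), hg0 s (fun h => hs h.1), zero_smul]
      · refine Continuous.integrable_of_hasCompactSupport ?_ ?_
        · have := hg.continuous
          fun_prop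
        · refine HasCompactSupport.of_support_subset_isCompact (isCompact_closedBall (0 : 𝔼) R)
            fun z hz => ?_
          by_contra h
          refine hz ?_
          rw [mem_closedBall_zero_iff, not_le] at h
          change g ‖z‖ * _ = 0
          rw [hg0 _ fun h' => absurd h'.2 h.le.not_gt, zero_mul])
  have hae : f =ᵐ[volume.restrict (Ioo 0 R)] fun _ => 0 :=
    (ae_restrict_iff' measurableSet_Ioo).2 key
  have := Measure.eqOn_open_of_ae_eq hae isOpen_Ioo hfc.continuousOn continuousOn_const ⟨hρ, hρR⟩
  simp only [hf] at this
  simpa [hρ.ne'] using this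

end Flux

section MeanValue

variable {n : ℕ}

local notation "𝔼" => EuclideanSpace ℝ (Fin n)

/-- The Laplacian, in coordinates. -/
noncomputable def coordLaplacian (v : EuclideanSpace ℝ (Fin n) → ℝ)
    (z : EuclideanSpace ℝ (Fin n)) : ℝ :=
  ∑ i, fderiv ℝ (fderiv ℝ v) z (EuclideanSpace.single i 1) (EuclideanSpace.single i 1)

lemma coord_eq_inner (w : 𝔼) (i : Fin n) : w i = inner ℝ w (EuclideanSpace.single i 1) := by
  simp [EuclideanSpace.inner_single_right]

lemma continuous_integral_sphere {F : ℝ → 𝔼 → ℝ} (hF : Continuous (Function.uncurry F)) :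
    Continuous fun s => ∫ η : sphere (0 : 𝔼) 1, F s (η : 𝔼) ∂(volume : Measure 𝔼).toSphere := by
  have hc : Continuous (Function.uncurry fun (s : ℝ) (η : sphere (0 : 𝔼) 1) => F s (η : 𝔼)) :=
    hF.comp (by fun_prop : Continuous fun p : ℝ × sphere (0 : 𝔼) 1 => (p.1, (p.2 : 𝔼)))
  have := continuous_parametric_integral_of_continuous
    (μ := (volume : Measure 𝔼).toSphere) hc isCompact_univ
  simpa only [Measure.restrict_univ] using this

lemma integrable_sphere {F : 𝔼 → ℝ} (hF : Continuous F) :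
    Integrable (fun η : sphere (0 : 𝔼) 1 => F (η : 𝔼)) (volume : Measure 𝔼).toSphere :=
  (hF.comp continuous_subtype_val).integrable_of_hasCompactSupport
    (HasCompactSupport.of_compactSpace _)

lemma hasDerivAt_integral_sphere {F F' : ℝ → 𝔼 → ℝ} (hF : Continuous (Function.uncurry F))
    (hF' : Continuous (Function.uncurry F'))
    (hd : ∀ s η, HasDerivAt (fun s => F s η) (F' s η) s) (s : ℝ) :
    HasDerivAt (fun s => ∫ η : sphere (0 : 𝔼) 1, F s (η : 𝔼) ∂(volume : Measure 𝔼).toSphere)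
      (∫ η : sphere (0 : 𝔼) 1, F' s (η : 𝔼) ∂(volume : Measure 𝔼).toSphere) s := by
  obtain ⟨C, hC⟩ := ((isCompact_closedBall s 1).prod (isCompact_sphere (0 : 𝔼) 1)).exists_bound_of_continuousOn
    hF'.continuousOn
  have hs : ∀ s, Continuous (F s) := fun s => hF.comp (by fun_prop : Continuous fun η : 𝔼 => (s, η))
  have hs' : ∀ s, Continuous (F' s) := fun s =>
    hF'.comp (by fun_prop : Continuous fun η : 𝔼 => (s, η))
  refine (hasDerivAt_integral_of_dominated_loc_of_deriv_le (bound := fun _ => C)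
    (μ := (volume : Measure 𝔼).toSphere) (F := fun s (η : sphere (0 : 𝔼) 1) => F s (η : 𝔼))
    (F' := fun s (η : sphere (0 : 𝔼) 1) => F' s (η : 𝔼)) (ball_mem_nhds s one_pos) ?_ ?_ ?_ ?_ ?_ ?_).2
  · exact Eventually.of_forall fun t => (integrable_sphere (hs t)).aestronglyMeasurable
  · exact integrable_sphere (hs s)
  · exact (integrable_sphere (hs' s)).aestronglyMeasurable
  · exact ae_of_all _ fun η t ht => hC (t, η) ⟨ball_subset_closedBall ht, η.2⟩
  · exact integrable_const _
  · exact ae_of_all _ fun η t _ => hd t η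

/-- Isotropy of the second moments of the sphere. -/
lemma integral_sphere_inner_mul_inner [NeZero n] (l m : 𝔼) :
    n * ∫ η : sphere (0 : 𝔼) 1, inner ℝ (η : 𝔼) l * inner ℝ m (η : 𝔼)
        ∂(volume : Measure 𝔼).toSphere
      = (volume : Measure 𝔼).toSphere.real univ * inner ℝ l m := by
  have hn : (n : ℝ) ≠ 0 := Nat.cast_ne_zero.2 (NeZero.ne n)
  have hd : ∀ z : 𝔼, HasFDerivAt (fun z : 𝔼 => (inner ℝ l z : ℝ) • m - ((inner ℝ l m : ℝ) / n) • z)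
      ((innerSL ℝ l).smulRight m - ((inner ℝ l m : ℝ) / n) • ContinuousLinearMap.id ℝ 𝔼) z :=
    fun z => ((innerSL ℝ l).smulRight m
      - ((inner ℝ l m : ℝ) / n) • ContinuousLinearMap.id ℝ 𝔼).hasFDerivAt
  have h := integral_sphere_inner_eq_zero (n := n) (R := 2) (ρ := 1)
    (Y := fun z => (inner ℝ l z : ℝ) • m - ((inner ℝ l m : ℝ) / n) • z)
    (((innerSL ℝ l).contDiff.smul contDiff_const).sub (contDiff_id.const_smul _)) (fun z _ => by
      rw [(hd z).fderiv]
      simp [Finset.sum_sub_distrib, EuclideanSpace.inner_single_right]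
      rw [mul_div_cancel₀ _ hn, PiLp.inner_apply]
      simp [mul_comm]) one_pos one_lt_two
  simp only [one_smul, inner_sub_left, inner_smul_left, real_inner_self_eq_norm_sq,
    conj_trivial, norm_eq_of_mem_sphere] at h
  rw [integral_sub (integrable_sphere (F := fun η => (inner ℝ l η : ℝ) * inner ℝ m η)
    (by fun_prop)) (integrable_const _)] at h
  simp at h
  simp only [real_inner_comm l]
  rw [sub_eq_zero.1 h, Measure.toSphere_real_apply_univ, finrank_euclideanSpace_fin]
  field_simp

lemma eq_of_eqOn_Ioo {f : ℝ → ℝ} (hf : Continuous f) {c R : ℝ} (hR : 0 < R)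
    (h : ∀ s ∈ Ioo 0 R, f s = c) : f 0 = c := by
  have h1 : Tendsto f (𝓝[>] 0) (𝓝 (f 0)) := hf.continuousAt.mono_left nhdsWithin_le_nhds
  have h2 : Tendsto f (𝓝[>] 0) (𝓝 c) :=
    tendsto_const_nhds.congr' (by
      filter_upwards [Ioo_mem_nhdsGT hR] with s hs using (h s hs).symm)
  exact tendsto_nhds_unique h1 h2

section

variable {v : EuclideanSpace ℝ (Fin n) → ℝ}

lemma contDiff_gradient (hv : ContDiff ℝ 2 v) : ContDiff ℝ 1 (gradient v) := by
  have : ContDiff ℝ 1 (fderiv ℝ v) := hv.fderiv_right (by norm_num)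
  exact (InnerProductSpace.toDual ℝ 𝔼).symm.toContinuousLinearEquiv.contDiff.comp this

lemma fderiv_gradient_apply (hv : ContDiff ℝ 2 v) (z m : 𝔼) (i : Fin n) :
    (fderiv ℝ (gradient v) z m) i = fderiv ℝ (fderiv ℝ v) z m (EuclideanSpace.single i 1) := by
  have h1 : ContDiff ℝ 1 (fderiv ℝ v) := hv.fderiv_right (by norm_num)
  have h2 := (InnerProductSpace.toDual ℝ 𝔼).symm.toContinuousLinearEquiv.hasFDerivAt.comp z
    (h1.differentiable one_ne_zero z).hasFDerivAt
  have h3 : fderiv ℝ (gradient v) z = _ := h2.fderiv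
  rw [h3]
  rw [coord_eq_inner]
  simp

lemma hasDerivAt_comp_smul (hv : ContDiff ℝ 2 v) (s : ℝ) (η : 𝔼) :
    HasDerivAt (fun s : ℝ => v (s • η)) (inner ℝ (gradient v (s • η)) η) s := by
  have h1 : HasDerivAt (fun s : ℝ => s • η) η s := by
    simpa using (hasDerivAt_id s).smul_const η
  have h2 := (hv.differentiable two_ne_zero (s • η)).hasFDerivAt.comp_hasDerivAt s h1
  rw [show inner ℝ (gradient v (s • η)) η = fderiv ℝ v (s • η) η by simp [gradient]]
  exact h2

/-- The mean value property. -/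
lemma integral_sphere_eq_of_harmonic [NeZero n] (hv : ContDiff ℝ 2 v) {R : ℝ} (hR : 1 < R)
    (hl : ∀ z ∈ ball (0 : 𝔼) R, coordLaplacian v z = 0) :
    ∫ η : sphere (0 : 𝔼) 1, v (η : 𝔼) ∂(volume : Measure 𝔼).toSphere
      = (volume : Measure 𝔼).toSphere.real univ * v 0 := by
  have hvc := hv.continuous
  have hgc := (contDiff_gradient hv).continuous
  have hc := continuous_integral_sphere (n := n) (F := fun s η => v (s • η))
    (by simp only [Function.uncurry_def]; fun_prop)
  have hd := hasDerivAt_integral_sphere (n := n) (F := fun s η => v (s • η))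
    (F' := fun s η => inner ℝ (gradient v (s • η)) η)
    (by simp only [Function.uncurry_def]; fun_prop) (by simp only [Function.uncurry_def]; fun_prop)
    (hasDerivAt_comp_smul hv)
  have h0 := eq_of_eqOn_Ioo hc (zero_lt_one.trans hR) (fun s hs =>
    isOpen_Ioo.is_const_of_deriv_eq_zero isPreconnected_Ioo
      (fun t _ => (hd t).differentiableAt.differentiableWithinAt) (fun t ht => by
        rw [(hd t).deriv]
        refine integral_sphere_inner_eq_zero (contDiff_gradient hv) (R := R) ?_ ht.1 ht.2
        intro z hz
        simp only [fderiv_gradient_apply hv]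
        exact hl z hz) hs (⟨one_pos, hR⟩ : (1 : ℝ) ∈ Ioo 0 R))
  simp only [zero_smul, one_smul, integral_const, smul_eq_mul] at h0
  exact h0.symm

/-- The gradient of a harmonic function at the centre, in terms of its values on the sphere. -/
lemma integral_sphere_inner_mul_of_harmonic [NeZero n] (hv : ContDiff ℝ 2 v) {R : ℝ} (hR : 1 < R)
    (hl : ∀ z ∈ ball (0 : 𝔼) R, coordLaplacian v z = 0) (l : 𝔼) :
    n * ∫ η : sphere (0 : 𝔼) 1, inner ℝ (η : 𝔼) l * v (η : 𝔼) ∂(volume : Measure 𝔼).toSphere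
      = (volume : Measure 𝔼).toSphere.real univ * fderiv ℝ v 0 l := by
  have hvc := hv.continuous
  have hgC := contDiff_gradient hv
  have hgc := hgC.continuous
  have hd := hasDerivAt_integral_sphere (n := n) (F := fun s η => inner ℝ η l * v (s • η))
    (F' := fun s η => inner ℝ η l * inner ℝ (gradient v (s • η)) η)
    (by simp only [Function.uncurry_def]; fun_prop) (by simp only [Function.uncurry_def]; fun_prop)
    (fun s η => (hasDerivAt_comp_smul hv s η).const_mul _)
  have hc' := continuous_integral_sphere (n := n)
    (F := fun s η => inner ℝ η l * inner ℝ (gradient v (s • η)) η)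
    (by simp only [Function.uncurry_def]; fun_prop)
  set C : ℝ → ℝ := fun s => ∫ η : sphere (0 : 𝔼) 1, inner ℝ (η : 𝔼) l * v (s • (η : 𝔼))
    ∂(volume : Measure 𝔼).toSphere with hC
  set C' : ℝ → ℝ := fun s => ∫ η : sphere (0 : 𝔼) 1,
    inner ℝ (η : 𝔼) l * inner ℝ (gradient v (s • (η : 𝔼))) (η : 𝔼)
    ∂(volume : Measure 𝔼).toSphere with hC'
  have hode : ∀ s ∈ Ioo 0 R, s * C' s = C s := fun s hs => by
    have h := integral_sphere_inner_eq_zero (n := n) (R := R) (ρ := s)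
      (Y := fun z => (inner ℝ l z : ℝ) • gradient v z - v z • l)
      (((innerSL ℝ l).contDiff.smul hgC).sub ((hv.of_le one_le_two).smul contDiff_const)) (fun z hz => by
        have h1 : HasFDerivAt (fun z : 𝔼 => (inner ℝ l z : ℝ)) (innerSL ℝ l) z :=
          (innerSL ℝ l).hasFDerivAt
        have h2 := (h1.smul (hgC.differentiable one_ne_zero z).hasFDerivAt).sub
          ((hv.differentiable two_ne_zero z).hasFDerivAt.smul_const l)
        have h3 : fderiv ℝ (fun z => (inner ℝ l z : ℝ) • gradient v z - v z • l) z = _ := h2.fderiv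
        have h4 := hl z hz
        have h5 : ∀ i, gradient v z i = fderiv ℝ v z (EuclideanSpace.single i 1) := fun i => by
          have : inner ℝ (gradient v z) (EuclideanSpace.single i 1)
              = fderiv ℝ v z (EuclideanSpace.single i 1) := by
            simp only [gradient, InnerProductSpace.toDual_symm_apply]
          rw [← this, coord_eq_inner]
        rw [h3]
        unfold coordLaplacian at h4
        simp [fderiv_gradient_apply hv,
          ← Finset.mul_sum, h4, h5, EuclideanSpace.inner_single_right, mul_comm]) hs.1 hs.2
    have h6 : ∀ η : 𝔼, inner ℝ ((inner ℝ l (s • η) : ℝ) • gradient v (s • η) - v (s • η) • l) η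
        = s * (inner ℝ η l * inner ℝ (gradient v (s • η)) η) - inner ℝ η l * v (s • η) :=
      fun η => by
        rw [inner_sub_left, inner_smul_left, inner_smul_left, inner_smul_right,
          real_inner_comm η l]
        simp
        ring
    simp only [h6] at h
    rw [integral_sub (integrable_sphere (F := fun η => s * ((inner ℝ η l : ℝ)
      * inner ℝ (gradient v (s • η)) η)) (by fun_prop))
      (integrable_sphere (F := fun η => (inner ℝ η l : ℝ) * v (s • η)) (by fun_prop)),
      integral_const_mul, sub_eq_zero] at h
    exact h
  have hq : ∀ s ∈ Ioo 0 R, HasDerivAt (fun s => C s / s) 0 s := fun s hs => by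
    have := (hd s).div (hasDerivAt_id s) hs.1.ne'
    refine this.congr_deriv ?_
    have := hode s hs
    simp only [id]
    rw [div_eq_zero_iff]
    left
    change C' s * s - C s * 1 = 0
    linarith
  have hC1 : ∀ s ∈ Ioo 0 R, C' s = C 1 := fun s hs => by
    have := isOpen_Ioo.is_const_of_deriv_eq_zero isPreconnected_Ioo
      (fun t ht => (hq t ht).differentiableAt.differentiableWithinAt)
      (fun t ht => (hq t ht).deriv) hs (⟨one_pos, hR⟩ : (1 : ℝ) ∈ Ioo 0 R)
    rw [div_one, ← hode s hs, mul_div_cancel_left₀ _ hs.1.ne'] at this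
    exact this
  have h0 := eq_of_eqOn_Ioo hc' (zero_lt_one.trans hR) hC1
  have h1 := integral_sphere_inner_mul_inner l (gradient v 0)
  simp only [hC, hC', zero_smul, one_smul] at h0
  rw [← h0, h1]
  congr 1
  rw [real_inner_comm]
  simp [gradient]

end

end MeanValue

section LocalMeanValue

variable {n : ℕ}

local notation "𝔼" => EuclideanSpace ℝ (Fin n)

lemma coordLaplacian_congr {v w : EuclideanSpace ℝ (Fin n) → ℝ} {z : EuclideanSpace ℝ (Fin n)}
    (h : v =ᶠ[𝓝 z] w) : coordLaplacian v z = coordLaplacian w z := by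
  unfold coordLaplacian
  rw [h.fderiv.fderiv_eq]

/-- A function harmonic near the closed unit ball agrees there with a globally smooth function. -/
lemma exists_contDiff_eqOn_ball {v : 𝔼 → ℝ} {U : Set 𝔼} (hU : IsOpen U)
    (hb : closedBall 0 1 ⊆ U) (hv : ContDiffOn ℝ 2 v U) (hl : ∀ z ∈ U, coordLaplacian v z = 0) :
    ∃ w : 𝔼 → ℝ, ∃ R : ℝ, 1 < R ∧ ContDiff ℝ 2 w ∧ EqOn w v (ball 0 R) ∧
      ∀ z ∈ ball (0 : 𝔼) R, coordLaplacian w z = 0 := by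
  obtain ⟨δ, hδ, hδU⟩ := (isCompact_closedBall (0 : 𝔼) 1).exists_cthickening_subset_open hU hb
  rw [cthickening_closedBall hδ.le zero_le_one] at hδU
  let f : ContDiffBump (0 : 𝔼) := ⟨1 + δ / 2, δ + 1, by linarith, by linarith⟩
  have hts : tsupport f ⊆ U := by
    rw [f.tsupport_eq]
    exact hδU
  have heq : EqOn (fun z => f z * v z) v (ball 0 (1 + δ / 2)) := fun z hz => by
    change f z * v z = v z
    rw [f.one_of_mem_closedBall (ball_subset_closedBall hz), one_mul]
  refine ⟨fun z => f z * v z, 1 + δ / 2, by linarith, ?_, heq, fun z hz => ?_⟩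
  · rw [contDiff_iff_contDiffAt]
    intro z
    by_cases hz : z ∈ tsupport f
    · exact f.contDiff.contDiffAt.mul (hv.contDiffAt (hU.mem_nhds (hts hz)))
    · have : (fun z => f z * v z) =ᶠ[𝓝 z] fun _ => 0 := by
        filter_upwards [notMem_tsupport_iff_eventuallyEq.1 hz] with y hy
        rw [hy]
        simp
      exact contDiffAt_const.congr_of_eventuallyEq this
  · rw [coordLaplacian_congr (heq.eventuallyEq_of_mem (isOpen_ball.mem_nhds hz))]
    refine hl z (hδU (closedBall_subset_closedBall ?_ (ball_subset_closedBall hz)))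
    linarith

/-- A bound at the centre for a harmonic function in terms of a bound on the unit sphere. -/
lemma sphere_mul_fderiv_sub_le [NeZero n] {v : 𝔼 → ℝ} {U : Set 𝔼} (hU : IsOpen U)
    (hb : closedBall 0 1 ⊆ U) (hv : ContDiffOn ℝ 2 v U) (hl : ∀ z ∈ U, coordLaplacian v z = 0)
    {W : 𝔼 → ℝ} (hW : ContinuousOn W (sphere 0 1)) {M : ℝ} (hM : ∀ η ∈ sphere (0 : 𝔼) 1, |v η| ≤ M * W η)
    (x l : 𝔼) :
    (volume : Measure 𝔼).toSphere.real univ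
        * (fderiv ℝ v 0 l - ((n : ℝ) - 2) * v 0 * inner ℝ x l)
      ≤ n * (M * ∫ η : sphere (0 : 𝔼) 1, |inner ℝ ((η : 𝔼) - (((n : ℝ) - 2) / n) • x) l| * W (η : 𝔼)
          ∂(volume : Measure 𝔼).toSphere) := by
  obtain ⟨w, R, hR, hw, hwv, hlw⟩ := exists_contDiff_eqOn_ball hU hb hv hl
  have hn : (n : ℝ) ≠ 0 := Nat.cast_ne_zero.2 (NeZero.ne n)
  have hwc := hw.continuous
  have h0 : (0 : 𝔼) ∈ ball 0 R := mem_ball_self (by linarith)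
  have hwη : ∀ η ∈ sphere (0 : 𝔼) 1, w η = v η := fun η hη =>
    hwv (by rw [mem_ball_zero_iff, mem_sphere_zero_iff_norm.1 hη]; exact hR)
  have hf : fderiv ℝ w 0 = fderiv ℝ v 0 :=
    (hwv.eventuallyEq_of_mem (isOpen_ball.mem_nhds h0)).fderiv_eq
  have h1 := integral_sphere_eq_of_harmonic hw hR hlw
  have h2 := integral_sphere_inner_mul_of_harmonic hw hR hlw l
  rw [hf] at h2
  rw [hwv h0] at h1
  have hWi : Integrable (fun η : sphere (0 : 𝔼) 1 =>
      |inner ℝ ((η : 𝔼) - (((n : ℝ) - 2) / n) • x) l| * W (η : 𝔼))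
      (volume : Measure 𝔼).toSphere := by
    have hW' : Continuous fun η : sphere (0 : 𝔼) 1 => W η := hW.domRestrict
    refine Continuous.integrable_of_hasCompactSupport ?_ (HasCompactSupport.of_compactSpace _)
    exact Continuous.mul (by fun_prop) hW'
  have key : (volume : Measure 𝔼).toSphere.real univ
        * (fderiv ℝ v 0 l - ((n : ℝ) - 2) * v 0 * inner ℝ x l)
      = n * ∫ η : sphere (0 : 𝔼) 1, inner ℝ ((η : 𝔼) - (((n : ℝ) - 2) / n) • x) l * w (η : 𝔼)
          ∂(volume : Measure 𝔼).toSphere := by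
    have : ∀ η : 𝔼, inner ℝ (η - (((n : ℝ) - 2) / n) • x) l * w η
        = inner ℝ η l * w η - (((n : ℝ) - 2) / n * inner ℝ x l) * w η := fun η => by
      rw [inner_sub_left, inner_smul_left]
      simp
      ring
    simp only [this]
    rw [integral_sub (integrable_sphere (F := fun η => (inner ℝ η l : ℝ) * w η) (by fun_prop))
      (integrable_sphere (F := fun η => (((n : ℝ) - 2) / n * inner ℝ x l) * w η) (by fun_prop)),
      integral_const_mul, h1, mul_sub, mul_sub, h2]
    field_simp
  rw [key]
  refine mul_le_mul_of_nonneg_left ?_ (Nat.cast_nonneg n)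
  rw [← integral_const_mul]
  refine integral_mono ?_ (hWi.const_mul M) fun η => ?_
  · exact integrable_sphere (F := fun η => (inner ℝ (η - (((n : ℝ) - 2) / n) • x) l : ℝ) * w η)
      (by fun_prop)
  · change _ ≤ M * (_ * W (η : 𝔼))
    calc _ ≤ |inner ℝ ((η : 𝔼) - (((n : ℝ) - 2) / n) • x) l * w (η : 𝔼)| := le_abs_self _
      _ = |inner ℝ ((η : 𝔼) - (((n : ℝ) - 2) / n) • x) l| * |v (η : 𝔼)| := by
        rw [abs_mul, hwη _ η.2]
      _ ≤ |inner ℝ ((η : 𝔼) - (((n : ℝ) - 2) / n) • x) l| * (M * W (η : 𝔼)) := by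
        gcongr
        exact hM _ η.2
      _ = _ := by ring

end LocalMeanValue

section Kelvin

variable {n : ℕ}

local notation "𝔼" => EuclideanSpace ℝ (Fin n)

lemma fderiv_fderiv_apply_of_line {E : Type*} [NormedAddCommGroup E] [NormedSpace ℝ E]
    {v : E → ℝ} {z e : E} (hv : ContDiffAt ℝ 2 v z)
    {f' : ℝ → ℝ} {f'' : ℝ} (h1 : ∀ᶠ t in 𝓝 (0 : ℝ), HasDerivAt (fun t => v (z + t • e)) (f' t) t)
    (h2 : HasDerivAt f' f'' 0) : fderiv ℝ (fderiv ℝ v) z e e = f'' := by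
  have hline : ∀ t : ℝ, HasDerivAt (fun t : ℝ => z + t • e) e t := fun t => by
    simpa using ((hasDerivAt_id t).smul_const e).const_add z
  have hc : Tendsto (fun t : ℝ => z + t • e) (𝓝 0) (𝓝 z) := by
    have := (hline 0).continuousAt.tendsto
    simpa using this
  have h3 : ∀ᶠ t in 𝓝 (0 : ℝ), f' t = fderiv ℝ v (z + t • e) e := by
    filter_upwards [h1, hc.eventually (hv.eventually (by simp))] with t ht1 ht2
    have h4 := (ht2.differentiableAt two_ne_zero).hasFDerivAt.comp_hasDerivAt t (hline t)
    exact ht1.unique h4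
  have h5 : DifferentiableAt ℝ (fderiv ℝ v) z :=
    (hv.fderiv_right (m := 1) (by norm_num)).differentiableAt one_ne_zero
  have h6 : HasDerivAt (fun t : ℝ => fderiv ℝ v (z + t • e) e) (fderiv ℝ (fderiv ℝ v) z e e) 0 := by
    have h7 : HasFDerivAt (fderiv ℝ v) (fderiv ℝ (fderiv ℝ v) z) (z + (0 : ℝ) • e) := by
      simpa using h5.hasFDerivAt
    have h8 := h7.comp_hasDerivAt 0 (hline 0)
    exact ((ContinuousLinearMap.apply ℝ ℝ e).hasFDerivAt.comp_hasDerivAt 0 h8)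
  exact h6.unique (h2.congr_of_eventuallyEq (h3.mono fun t ht => ht.symm))

/-- Inversion about `a`, with ratio `c`. -/
noncomputable def ballInversion {E : Type*} [NormedAddCommGroup E] [NormedSpace ℝ E]
    (a : E) (c : ℝ) (y : E) : E := a + (c / ‖y - a‖ ^ 2) • (y - a)

/-- The Kelvin transform associated with `ballInversion a c`. -/
noncomputable def kelvinTransform {E : Type*} [NormedAddCommGroup E] [NormedSpace ℝ E]
    (lam : ℝ) (a : E) (c : ℝ) (u : E → ℝ) (y : E) : ℝ :=
  (‖y - a‖ ^ 2) ^ (-lam) * u (ballInversion a c y)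

lemma contDiffAt_ballInversion {a : 𝔼} {c : ℝ} {y : 𝔼} (hy : y ≠ a) :
    ContDiffAt ℝ 2 (ballInversion a c) y := by
  have : ‖y - a‖ ^ 2 ≠ 0 := by simpa [sub_eq_zero] using hy
  have h1 : ContDiffAt ℝ 2 (fun y : 𝔼 => ‖y - a‖ ^ 2) y := by
    exact ((contDiff_norm_sq ℝ).comp (contDiff_id.sub contDiff_const)).contDiffAt
  unfold ballInversion
  exact contDiffAt_const.add ((contDiffAt_const.div h1 this).smul (contDiffAt_id.sub contDiffAt_const))

lemma contDiffAt_kelvinTransform {lam : ℝ} {a : 𝔼} {c : ℝ} {u : 𝔼 → ℝ} {y : 𝔼} (hy : y ≠ a)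
    (hu : ContDiffAt ℝ 2 u (ballInversion a c y)) :
    ContDiffAt ℝ 2 (kelvinTransform lam a c u) y := by
  have : ‖y - a‖ ^ 2 ≠ 0 := by simpa [sub_eq_zero] using hy
  have h1 : ContDiffAt ℝ 2 (fun y : 𝔼 => ‖y - a‖ ^ 2) y := by
    exact ((contDiff_norm_sq ℝ).comp (contDiff_id.sub contDiff_const)).contDiffAt
  unfold kelvinTransform
  exact (h1.rpow_const_of_ne this).mul (hu.comp y (contDiffAt_ballInversion hy))

/-- The pure second derivatives of a Kelvin transform. -/
lemma fderiv_fderiv_kelvinTransform {lam : ℝ} {a : 𝔼} {c : ℝ} {u : 𝔼 → ℝ} {z e : 𝔼} (hz : z ≠ a)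
    (he : ‖e‖ = 1) (hu : ContDiffAt ℝ 2 u (ballInversion a c z)) {Q d : ℝ}
    (hQ : Q = ‖z - a‖ ^ 2) (hd : d = inner ℝ (z - a) e) {ψ' ψ'' : 𝔼}
    (hψ' : ψ' = (-(2 * c * d / Q ^ 2)) • (z - a) + (c / Q) • e)
    (hψ'' : ψ'' = (8 * c * d ^ 2 / Q ^ 3 - 2 * c / Q ^ 2) • (z - a) - (4 * c * d / Q ^ 2) • e) :
    fderiv ℝ (fderiv ℝ (kelvinTransform lam a c u)) z e e
      = Q ^ (-lam) * ((4 * lam * (lam + 1) * d ^ 2 / Q ^ 2 - 2 * lam / Q) * u (ballInversion a c z)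
        - 4 * lam * d / Q * fderiv ℝ u (ballInversion a c z) ψ'
        + fderiv ℝ u (ballInversion a c z) ψ''
        + fderiv ℝ (fderiv ℝ u) (ballInversion a c z) ψ' ψ') := by
  have hQ0 : 0 < Q := by
    rw [hQ]
    have : z - a ≠ 0 := sub_ne_zero.2 hz
    positivity
  set y := z - a with hy
  set q : ℝ → ℝ := fun t => Q + 2 * d * t + t ^ 2 with hq
  have hqn : ∀ t : ℝ, ‖z + t • e - a‖ ^ 2 = q t := fun t => by
    have : z + t • e - a = y + t • e := by rw [hy]; abel
    rw [this, norm_add_sq_real, norm_smul, he, inner_smul_right, ← hQ, ← hd, hq]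
    simp
    ring
  have hq' : ∀ t, HasDerivAt q (2 * d + 2 * t) t := fun t => by
    have := (((hasDerivAt_id t).const_mul (2 * d)).const_add Q).add ((hasDerivAt_id t).pow 2)
    refine this.congr_deriv ?_
    simp
  have hq0 : q 0 = Q := by simp [hq]
  set Ψ : ℝ → 𝔼 := fun t => a + (c / q t) • (y + t • e) with hΨ
  have hinv : ∀ t : ℝ, ballInversion a c (z + t • e) = Ψ t := fun t => by
    have : z + t • e - a = y + t • e := by rw [hy]; abel
    simp only [ballInversion]
    rw [hqn t, this]
  have hinv0 : ballInversion a c z = Ψ 0 := by simpa using hinv 0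
  set Ψ' : ℝ → 𝔼 := fun t => (-(c * (2 * d + 2 * t) / q t ^ 2)) • (y + t • e) + (c / q t) • e with hΨ'
  have hye : ∀ t : ℝ, HasDerivAt (fun t : ℝ => y + t • e) e t := fun t => by
    simpa using ((hasDerivAt_id t).smul_const e).const_add y
  have hcq : ∀ t, q t ≠ 0 → HasDerivAt (fun t => c / q t) (-(c * (2 * d + 2 * t) / q t ^ 2)) t :=
    fun t ht => by
      refine ((hasDerivAt_const t c).div (hq' t) ht).congr_deriv ?_
      ring
  have hΨd : ∀ t, q t ≠ 0 → HasDerivAt Ψ (Ψ' t) t := fun t ht => by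
    refine (((hcq t ht).smul (hye t)).const_add a).congr_deriv ?_
    rw [hΨ']
    exact add_comm _ _
  have hΨ'd : HasDerivAt Ψ' ψ'' 0 := by
    have ht : q 0 ≠ 0 := by rw [hq0]; exact hQ0.ne'
    have h1 : HasDerivAt (fun t => -(c * (2 * d + 2 * t) / q t ^ 2))
        (8 * c * d ^ 2 / Q ^ 3 - 2 * c / Q ^ 2) 0 := by
      have h2 : HasDerivAt (fun t : ℝ => c * (2 * d + 2 * t)) (c * 2) 0 := by
        simpa using (((hasDerivAt_id (0 : ℝ)).const_mul 2).const_add (2 * d)).const_mul c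
      refine ((h2.div ((hq' 0).pow 2) (pow_ne_zero 2 ht)).neg).congr_deriv ?_
      simp only [Pi.pow_apply, hq0]
      field_simp
      ring
    refine ((h1.smul (hye 0)).add ((hcq 0 ht).smul_const e)).congr_deriv ?_
    rw [hψ'', hq0]
    simp only [zero_smul, add_zero, mul_zero]
    module
  have hΨ'0 : Ψ' 0 = ψ' := by
    rw [hψ']
    simp only [hΨ', hq0, zero_smul, add_zero, mul_zero]
    congr 2
    ring
  have hqc : Continuous q := by fun_prop
  have hev : ∀ᶠ t in 𝓝 (0 : ℝ), 0 < q t :=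
    hqc.continuousAt.eventually (lt_mem_nhds (by rw [hq0]; exact hQ0))
  have hΨc : Tendsto Ψ (𝓝 0) (𝓝 (Ψ 0)) := (hΨd 0 (by rw [hq0]; exact hQ0.ne')).continuousAt
  rw [hinv0] at hu
  set p' : ℝ → ℝ := fun t => -lam * q t ^ (-lam - 1) * (2 * d + 2 * t) with hp'
  have hpd : ∀ t, 0 < q t → HasDerivAt (fun t => q t ^ (-lam)) (p' t) t := fun t ht => by
    refine ((hq' t).rpow_const (Or.inl ht.ne')).congr_deriv ?_
    rw [hp']
    ring
  have hp'd : HasDerivAt p' (Q ^ (-lam) * (4 * lam * (lam + 1) * d ^ 2 / Q ^ 2 - 2 * lam / Q)) 0 := by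
    have ht : 0 < q 0 := by rw [hq0]; exact hQ0
    have h2 : HasDerivAt (fun t : ℝ => 2 * d + 2 * t) 2 0 := by
      simpa using ((hasDerivAt_id (0 : ℝ)).const_mul 2).const_add (2 * d)
    refine ((((hq' 0).rpow_const (p := -lam - 1) (Or.inl ht.ne')).const_mul (-lam)).mul
      h2).congr_deriv ?_
    rw [hq0, Real.rpow_sub_one hQ0.ne', Real.rpow_sub_one hQ0.ne']
    field_simp
    ring
  have hline : ∀ᶠ t in 𝓝 (0 : ℝ), HasDerivAt (fun t => kelvinTransform lam a c u (z + t • e))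
      (p' t * u (Ψ t) + q t ^ (-lam) * fderiv ℝ u (Ψ t) (Ψ' t)) t := by
    filter_upwards [hev, hΨc.eventually (hu.eventually (by simp))] with t ht1 ht2
    have h1 := (ht2.differentiableAt two_ne_zero).hasFDerivAt.comp_hasDerivAt t (hΨd t ht1.ne')
    have h2 := (hpd t ht1).mul h1
    simp only [kelvinTransform, hqn, hinv]
    exact h2
  rw [hinv0]
  refine fderiv_fderiv_apply_of_line (contDiffAt_kelvinTransform hz (by rw [hinv0]; exact hu))
    hline ?_
  have ht : 0 < q 0 := by rw [hq0]; exact hQ0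
  have hΨd0 := hΨd 0 ht.ne'
  have h1 := (hu.differentiableAt two_ne_zero).hasFDerivAt.comp_hasDerivAt 0 hΨd0
  have h2 := ((hu.fderiv_right (m := 1) (by norm_num)).differentiableAt
    one_ne_zero).hasFDerivAt.comp_hasDerivAt 0 hΨd0
  refine ((hp'd.mul h1).add ((hpd 0 ht).mul (h2.clm_apply hΨ'd))).congr_deriv ?_
  simp only [Function.comp_apply, hΨ'0, hq0, hp', mul_zero, add_zero, Real.rpow_sub_one hQ0.ne']
  field_simp
  ring

/-- The Kelvin transform preserves harmonicity. -/
lemma coordLaplacian_kelvinTransform {a : 𝔼} {c : ℝ} {u : 𝔼 → ℝ} {z : 𝔼}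
    (hz : z ≠ a) (hu : ContDiffAt ℝ 2 u (ballInversion a c z))
    (hl : coordLaplacian u (ballInversion a c z) = 0) :
    coordLaplacian (kelvinTransform (((n : ℝ) - 2) / 2) a c u) z = 0 := by
  set y := z - a with hy
  set Q := ‖y‖ ^ 2 with hQ
  have hQ0 : Q ≠ 0 := by
    have : y ≠ 0 := sub_ne_zero.2 hz
    positivity
  set L := fderiv ℝ u (ballInversion a c z) with hL
  set H := fderiv ℝ (fderiv ℝ u) (ballInversion a c z) with hH
  set lam := ((n : ℝ) - 2) / 2 with hlam
  have hyi : ∀ i, inner ℝ y (EuclideanSpace.single i 1) = y i := fun i => (coord_eq_inner y i).symm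
  have hsum : y = ∑ i, y i • EuclideanSpace.single i (1 : ℝ) := by
    ext j
    simp [Pi.single_apply]
  have hs1 : ∑ i, y i ^ 2 = Q := by
    rw [hQ, EuclideanSpace.real_norm_sq_eq]
  have hs2 : ∑ i, y i * L (EuclideanSpace.single i 1) = L y := by
    conv_rhs => rw [hsum]
    simp
  have hs3 : ∑ i, y i * H (EuclideanSpace.single i 1) y = H y y := by
    conv_rhs => enter [1]; rw [hsum]
    simp [sum_apply]
  have hs4 : ∑ i, y i * H y (EuclideanSpace.single i 1) = H y y := by
    generalize H y = G
    conv_rhs => rw [hsum]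
    simp
  unfold coordLaplacian at hl ⊢
  rw [← hH] at hl
  have hterm : ∀ i, fderiv ℝ (fderiv ℝ (kelvinTransform lam a c u)) z
      (EuclideanSpace.single i 1) (EuclideanSpace.single i 1)
      = Q ^ (-lam) * ((4 * lam * (lam + 1) / Q ^ 2 * u (ballInversion a c z)
          + (8 * lam * c / Q ^ 3 + 8 * c / Q ^ 3) * L y + 4 * c ^ 2 / Q ^ 4 * H y y) * y i ^ 2
        + (-(2 * lam / Q) * u (ballInversion a c z) - 2 * c / Q ^ 2 * L y)
        + (-(4 * lam * c / Q ^ 2) - 4 * c / Q ^ 2) * (y i * L (EuclideanSpace.single i 1))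
        + (-(2 * c ^ 2 / Q ^ 3)) * (y i * H (EuclideanSpace.single i 1) y)
        + (-(2 * c ^ 2 / Q ^ 3)) * (y i * H y (EuclideanSpace.single i 1))
        + c ^ 2 / Q ^ 2 * H (EuclideanSpace.single i 1) (EuclideanSpace.single i 1)) := fun i => by
    rw [fderiv_fderiv_kelvinTransform hz (by simp) hu hQ (hyi i).symm
      (ψ' := (-(2 * c * y i / Q ^ 2)) • y + (c / Q) • EuclideanSpace.single i 1)
      (ψ'' := (8 * c * y i ^ 2 / Q ^ 3 - 2 * c / Q ^ 2) • y
        - (4 * c * y i / Q ^ 2) • EuclideanSpace.single i 1) rfl rfl, ← hL, ← hH]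
    simp only [map_add, map_sub, map_smul, add_apply, smul_apply, smul_eq_mul]
    field_simp
    ring
  simp only [hterm]
  rw [← Finset.mul_sum]
  simp only [Finset.sum_add_distrib, ← Finset.mul_sum, hs1, hs2, hs3, hs4, hl, Finset.sum_const,
    Finset.card_univ, Fintype.card_fin, nsmul_eq_mul]
  have hn : (n : ℝ) = 2 * lam + 2 := by rw [hlam]; ring
  rw [hn]
  field_simp
  ring

end Kelvin

section Recentre

variable {n : ℕ}

local notation "𝔼" => EuclideanSpace ℝ (Fin n)

lemma fderiv_kelvinTransform {lam : ℝ} {a : 𝔼} {c : ℝ} {u : 𝔼 → ℝ} {z : 𝔼} (hz : z ≠ a)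
    (hu : DifferentiableAt ℝ u (ballInversion a c z)) (e : 𝔼) :
    fderiv ℝ (kelvinTransform lam a c u) z e
      = (‖z - a‖ ^ 2) ^ (-lam) * (fderiv ℝ u (ballInversion a c z)
          ((c / ‖z - a‖ ^ 2) • e - (2 * c * inner ℝ (z - a) e / (‖z - a‖ ^ 2) ^ 2) • (z - a))
        - 2 * lam * inner ℝ (z - a) e / ‖z - a‖ ^ 2 * u (ballInversion a c z)) := by
  have hQ0 : ‖z - a‖ ^ 2 ≠ 0 := by simpa [sub_eq_zero] using hz
  have hs : HasFDerivAt (fun y : 𝔼 => y - a) (ContinuousLinearMap.id ℝ 𝔼) z :=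
    (hasFDerivAt_id z).sub_const a
  have hQ := hs.norm_sq
  have hi : HasFDerivAt (fun y : 𝔼 => c / ‖y - a‖ ^ 2) _ z :=
    ((hasDerivAt_inv hQ0).const_mul c).comp_hasFDerivAt z hQ
  have hφ : HasFDerivAt (ballInversion a c) _ z := (hi.smul hs).const_add a
  have h := (hQ.rpow_const (p := -lam) (Or.inl hQ0)).mul (hu.hasFDerivAt.comp z hφ)
  have h' : HasFDerivAt (kelvinTransform lam a c u) _ z := h
  rw [h'.fderiv]
  simp only [add_apply, smul_apply, ContinuousLinearMap.comp_apply, Function.comp_apply,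
    smul_eq_mul, Real.rpow_sub_one hQ0, ContinuousLinearMap.smulRight_apply,
    ContinuousLinearMap.id_apply, innerSL_apply_apply]
  generalize inner ℝ (z - a) e = d
  generalize fderiv ℝ u (ballInversion a c z) = L
  rw [map_add, map_sub, map_smul, map_smul, map_smul]
  generalize L (z - a) = p
  simp only [smul_eq_mul, nsmul_eq_mul]
  field_simp
  ring

lemma coordLaplacian_const_smul (k : ℝ) (u : 𝔼 → ℝ) (z : 𝔼) :
    coordLaplacian (k • u) z = k * coordLaplacian u z := by
  have h : fderiv ℝ (k • u) = k • fderiv ℝ u := by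
    ext1 y
    exact congrFun (fderiv_const_smul_field k) y
  unfold coordLaplacian
  have h2 : fderiv ℝ (k • fderiv ℝ u) z = k • fderiv ℝ (fderiv ℝ u) z :=
    congrFun (fderiv_const_smul_field (F := 𝔼 →L[ℝ] ℝ) (f := fderiv ℝ u) k) z
  rw [h, h2, Finset.mul_sum]
  simp

lemma norm_sq_ballInversion {a y : 𝔼} {c : ℝ} (ha : ‖a‖ ^ 2 = 1 + c) (hy : y ≠ a) :
    ‖ballInversion a c y‖ ^ 2 = 1 - c * (1 - ‖y‖ ^ 2) / ‖y - a‖ ^ 2 := by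
  have hQ0 : ‖y - a‖ ^ 2 ≠ 0 := by simpa [sub_eq_zero] using hy
  have h1 : inner ℝ a (y - a) = (‖y‖ ^ 2 - (1 + c) - ‖y - a‖ ^ 2) / 2 := by
    have := norm_sub_sq_real y a
    rw [inner_sub_right, real_inner_self_eq_norm_sq, real_inner_comm]
    linarith
  rw [ballInversion, norm_add_sq_real, inner_smul_right, norm_smul, mul_pow, h1, ha,
    Real.norm_eq_abs, sq_abs]
  generalize ‖y - a‖ ^ 2 = Q at hQ0
  field_simp
  ring

set_option maxHeartbeats 400000 in
/-- Transplanting a harmonic function along a Möbius automorphism of the ball which takes the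
origin to `x`. -/
lemma exists_harmonic_recentred {u : 𝔼 → ℝ} {R M : ℝ} (hR : 1 < R)
    (hu : ContDiffOn ℝ 2 u (ball 0 R)) (hl : ∀ z ∈ ball 0 R, coordLaplacian u z = 0)
    (hM : ∀ y ∈ closedBall 0 1, |u y| ≤ M) {x : 𝔼} (hx : ‖x‖ < 1) (l : 𝔼) :
    ∃ (v : 𝔼 → ℝ) (U : Set 𝔼) (l' : 𝔼), IsOpen U ∧ closedBall 0 1 ⊆ U ∧ ContDiffOn ℝ 2 v U ∧
      (∀ z ∈ U, coordLaplacian v z = 0) ∧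
      (∀ η ∈ sphere 0 1, |v η| ≤ M * (‖x - η‖ ^ 2) ^ (-(((n : ℝ) - 2) / 2))) ∧ ‖l'‖ = ‖l‖ ∧
      fderiv ℝ v 0 l' - ((n : ℝ) - 2) * v 0 * inner ℝ x l' = (1 - ‖x‖ ^ 2) * fderiv ℝ u x l := by
  rcases eq_or_ne x 0 with rfl | hx0
  · refine ⟨u, ball 0 R, l, isOpen_ball, closedBall_subset_ball hR, hu, hl, fun η hη => ?_, rfl, by simp⟩
    have : ‖(0 : 𝔼) - η‖ = 1 := by simpa using hη
    rw [this]
    simpa using hM η (sphere_subset_closedBall hη)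
  have hr0 : 0 < ‖x‖ := norm_pos_iff.2 hx0
  obtain ⟨q, hq⟩ : ∃ q, q = ‖x‖ ^ 2 := ⟨_, rfl⟩
  rw [← hq]
  have hq0 : 0 < q := by rw [hq]; positivity
  have hq1 : q < 1 := by rw [hq]; nlinarith
  obtain ⟨a, ha⟩ : ∃ a : 𝔼, a = q⁻¹ • x := ⟨_, rfl⟩
  have ha2 : ‖a‖ ^ 2 = q⁻¹ := by
    rw [ha, norm_smul, mul_pow, Real.norm_eq_abs, sq_abs, ← hq]
    field_simp
  obtain ⟨c, hc⟩ : ∃ c, c = q⁻¹ - 1 := ⟨_, rfl⟩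
  have hc0 : 0 < c := by
    rw [hc, sub_pos]
    exact (one_lt_inv₀ hq0).2 hq1
  have hxx : inner ℝ x x = q := by rw [real_inner_self_eq_norm_sq, hq]
  have hexp : ∀ y : 𝔼, ‖y - a‖ ^ 2 = ‖y‖ ^ 2 - 2 * (q⁻¹ * inner ℝ y x) + q⁻¹ := fun y => by
    rw [norm_sub_sq_real, ha2, ha, inner_smul_right]
  have hφn : ∀ y : 𝔼, y ≠ a → ‖ballInversion a c y‖ ^ 2 = 1 - c * (1 - ‖y‖ ^ 2) / ‖y - a‖ ^ 2 :=
    fun y hy => norm_sq_ballInversion (by rw [ha2, hc]; ring) hy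
  have hφ0 : ballInversion a c 0 = x := by
    have : ‖(0 : 𝔼) - a‖ ^ 2 = q⁻¹ := by rw [zero_sub, norm_neg, ha2]
    rw [ballInversion, this, zero_sub, ha, hc, smul_neg, smul_smul, ← sub_eq_add_neg, ← sub_smul]
    have : q⁻¹ - (q⁻¹ - 1) / q⁻¹ * q⁻¹ = 1 := by field_simp; ring
    rw [this, one_smul]
  have hne : ∀ y ∈ closedBall (0 : 𝔼) 1, y ≠ a := fun y hy h => by
    have h1 : ‖y‖ ≤ 1 := by simpa using hy
    have h2 : ‖y‖ ^ 2 = q⁻¹ := by rw [h, ha2]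
    nlinarith [norm_nonneg y]
  obtain ⟨lam, hlam⟩ : ∃ lam, lam = ((n : ℝ) - 2) / 2 := ⟨_, rfl⟩
  obtain ⟨K, hK⟩ : ∃ K, K = q ^ (-lam) := ⟨_, rfl⟩
  have hKpos : 0 < K := hK ▸ Real.rpow_pos_of_pos hq0 _
  have hφc : ContinuousOn (ballInversion a c) {a}ᶜ := fun y hy =>
    (contDiffAt_ballInversion hy).continuousAt.continuousWithinAt
  have hball : ∀ y ∈ ({a}ᶜ ∩ ballInversion a c ⁻¹' ball 0 R : Set 𝔼),
      y ≠ a ∧ ContDiffAt ℝ 2 u (ballInversion a c y) := fun y hy =>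
    ⟨hy.1, hu.contDiffAt (isOpen_ball.mem_nhds hy.2)⟩
  have hφ1 : ∀ y ∈ closedBall (0 : 𝔼) 1, ballInversion a c y ∈ closedBall (0 : 𝔼) 1 := fun y hy => by
    have h1 : ‖y‖ ≤ 1 := by simpa using hy
    have h2 := hφn y (hne y hy)
    have h3 : 0 ≤ c * (1 - ‖y‖ ^ 2) / ‖y - a‖ ^ 2 := by
      have : 0 ≤ 1 - ‖y‖ ^ 2 := by nlinarith [norm_nonneg y]
      positivity
    rw [mem_closedBall_zero_iff]
    nlinarith [norm_nonneg (ballInversion a c y)]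
  obtain ⟨l', hl'⟩ : ∃ l' : 𝔼, l' = l - (2 * inner ℝ x l / q) • x := ⟨_, rfl⟩
  have hopen : IsOpen ({a}ᶜ ∩ ballInversion a c ⁻¹' ball 0 R) :=
    hφc.isOpen_inter_preimage isOpen_compl_singleton isOpen_ball
  have hsub : closedBall 0 1 ⊆ {a}ᶜ ∩ ballInversion a c ⁻¹' ball 0 R := fun y hy => by
    refine mem_inter (mem_compl_singleton_iff.2 (hne y hy)) (mem_preimage.2 ?_)
    exact closedBall_subset_ball hR (hφ1 y hy)
  refine ⟨K • kelvinTransform lam a c u, {a}ᶜ ∩ ballInversion a c ⁻¹' ball 0 R, l', hopen, hsub,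
    ?_, ?_, ?_, ?_, ?_⟩
  · intro y hy
    exact ((contDiffAt_kelvinTransform (hball y hy).1
      (hball y hy).2).const_smul K).contDiffWithinAt
  · intro y hy
    rw [coordLaplacian_const_smul, hlam, coordLaplacian_kelvinTransform (hball y hy).1 (hball y hy).2
      (hl _ hy.2), mul_zero]
  · intro η hη
    have hη1 : ‖η‖ = 1 := by simpa using hη
    have hηa : 0 ≤ ‖η - a‖ ^ 2 := by positivity
    have h1 : q * ‖η - a‖ ^ 2 = ‖x - η‖ ^ 2 := by
      rw [hexp, norm_sub_sq_real, hη1, real_inner_comm η x, ← hq]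
      field_simp
    rw [← h1, ← hlam, Real.mul_rpow hq0.le hηa, ← hK, Pi.smul_apply, smul_eq_mul, kelvinTransform, abs_mul,
      abs_mul, abs_of_pos hKpos, abs_of_nonneg (Real.rpow_nonneg hηa _), ← mul_assoc, mul_comm M]
    exact mul_le_mul_of_nonneg_left (hM _ (hφ1 η (sphere_subset_closedBall hη)))
      (mul_nonneg hKpos.le (Real.rpow_nonneg hηa _))
  · have : ‖l'‖ ^ 2 = ‖l‖ ^ 2 := by
      rw [hl', norm_sub_sq_real, inner_smul_right, norm_smul, mul_pow, Real.norm_eq_abs, sq_abs, ← hq,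
        real_inner_comm x l]
      field_simp
      ring
    exact (sq_eq_sq₀ (norm_nonneg _) (norm_nonneg _)).1 this
  · have h0 : (0 : 𝔼) ≠ a := hne 0 (by simp)
    have hud : DifferentiableAt ℝ u (ballInversion a c 0) :=
      (hball 0 (hsub (by simp))).2.differentiableAt two_ne_zero
    have hQ : ‖(0 : 𝔼) - a‖ ^ 2 = q⁻¹ := by rw [zero_sub, norm_neg, ha2]
    have hRl : inner ℝ x (l') = - inner ℝ x l := by
      rw [hl', inner_sub_right, inner_smul_right, hxx]
      field_simp
      ring
    have hd : inner ℝ ((0 : 𝔼) - a) (l') = q⁻¹ * inner ℝ x l := by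
      rw [zero_sub, inner_neg_left, ha, inner_smul_left, hRl]
      simp
    have hvec : (c / q⁻¹) • l' - (2 * c * (q⁻¹ * inner ℝ x l) / q⁻¹ ^ 2) • (0 - a)
        = (1 - q) • l := by
      simp only [hl', ha, hc, zero_sub]
      match_scalars <;> field_simp
      ring
    have hKQ : K * (q⁻¹) ^ (-lam) = 1 := by
      rw [hK, ← Real.mul_rpow hq0.le (by positivity), mul_inv_cancel₀ hq0.ne', Real.one_rpow]
    rw [fderiv_const_smul_field]
    simp only [Pi.smul_apply, smul_apply, smul_eq_mul, kelvinTransform.eq_1 lam a c u 0]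
    rw [fderiv_kelvinTransform h0 hud, hφ0, hQ, hd, hvec, hRl]
    simp only [map_smul, smul_eq_mul, ← mul_assoc, hKQ, mul_sub]
    rw [hlam]
    field_simp
    ring

end Recentre

section Rearrangement

lemma ENNReal.mul_add_mul_le_mul_add_mul {a b c d : ℝ≥0∞} (hab : a ≤ b) (hcd : c ≤ d) :
    a * d + b * c ≤ a * c + b * d := by
  obtain ⟨m, rfl⟩ := exists_add_of_le hab
  obtain ⟨k, rfl⟩ := exists_add_of_le hcd
  calc a * (c + k) + (a + m) * c ≤ a * (c + k) + (a + m) * c + m * k := le_self_add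
    _ = a * c + (a + m) * (c + k) := by ring

/-- If the even part of a weight `G` is, on every sphere, an increasing function of `|⟪w, e⟫|`,
then among all unit vectors `l` the integral of `|⟪w, l⟫| * G w` is largest for `l = e`. -/
lemma lintegral_abs_inner_mul_le {E : Type*} [NormedAddCommGroup E] [InnerProductSpace ℝ E]
    [FiniteDimensional ℝ E] [MeasurableSpace E] [BorelSpace E] {G : E → ℝ≥0∞} (hG : Measurable G)
    {e l : E} (he : ‖e‖ = 1) (hl : ‖l‖ = 1)
    (hmono : ∀ w w' : E, ‖w‖ = ‖w'‖ → |inner ℝ w e| ≤ |inner ℝ w' e| →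
      G w + G (-w) ≤ G w' + G (-w')) :
    ∫⁻ w, ENNReal.ofReal |inner ℝ w l| * G w ≤ ∫⁻ w, ENNReal.ofReal |inner ℝ w e| * G w := by
  have hm : ∀ v : E, Measurable fun w : E => ENNReal.ofReal |inner ℝ w v| := fun v =>
    ENNReal.measurable_ofReal.comp (by fun_prop)
  have hGe : Measurable fun w => G w + G (-w) := by fun_prop
  have hsymm : ∀ v : E, ∫⁻ w, ENNReal.ofReal |inner ℝ w v| * (G w + G (-w))
      = 2 * ∫⁻ w, ENNReal.ofReal |inner ℝ w v| * G w := fun v => by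
    simp only [mul_add]
    have hf : Measurable fun w => ENNReal.ofReal |inner ℝ w v| * G w := (hm v).mul hG
    rw [lintegral_add_left hf, two_mul]
    congr 1
    rw [← (Measure.measurePreserving_neg (volume : Measure E)).lintegral_comp hf]
    simp
  set R := (Submodule.span ℝ {e - l})ᗮ.reflection with hR
  have hRe : R e = l := Submodule.reflection_sub (by rw [he, hl])
  have hRl : R l = e := by rw [← hRe, hR, Submodule.reflection_reflection]
  have hswap : ∀ v : E, ∫⁻ w, ENNReal.ofReal |inner ℝ w v| * (G w + G (-w))
      = ∫⁻ w, ENNReal.ofReal |inner ℝ w (R v)| * (G (R w) + G (-(R w))) := fun v => by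
    have hf : Measurable fun w => ENNReal.ofReal |inner ℝ w v| * (G w + G (-w)) := (hm v).mul hGe
    rw [← R.measurePreserving.lintegral_comp hf]
    refine lintegral_congr fun w => ?_
    have : inner ℝ (R w) v = inner ℝ w (R v) := by
      rw [← R.inner_map_map w (R v), hR, Submodule.reflection_reflection]
    simp only [this]
  have hkey : ∀ w, ENNReal.ofReal |inner ℝ w l| * (G w + G (-w))
      + ENNReal.ofReal |inner ℝ w e| * (G (R w) + G (-(R w)))
      ≤ ENNReal.ofReal |inner ℝ w e| * (G w + G (-w))
      + ENNReal.ofReal |inner ℝ w l| * (G (R w) + G (-(R w))) := fun w => by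
    have h1 : inner ℝ (R w) e = inner ℝ w l := by
      rw [← hRl, R.inner_map_map]
    rcases le_total |inner ℝ w l| |inner ℝ w e| with h | h
    · have h2 := hmono (R w) w (R.norm_map w) (by rwa [h1])
      have h3 := ENNReal.mul_add_mul_le_mul_add_mul (ENNReal.ofReal_le_ofReal h) h2
      rwa [add_comm (ENNReal.ofReal |inner ℝ w e| * (G w + _))]
    · have h2 := hmono w (R w) (R.norm_map w).symm (by rwa [h1])
      have h3 := ENNReal.mul_add_mul_le_mul_add_mul (ENNReal.ofReal_le_ofReal h) h2
      rwa [add_comm]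
  have h := lintegral_mono (μ := (volume : Measure E)) hkey
  rw [lintegral_add_left (f := fun w => ENNReal.ofReal |inner ℝ w l| * (G w + G (-w)))
    ((hm l).mul hGe), lintegral_add_left
    (f := fun w => ENNReal.ofReal |inner ℝ w e| * (G w + G (-w))) ((hm e).mul hGe)] at h
  have h1 := hswap l
  have h2 := hswap e
  rw [hRl] at h1
  rw [hRe] at h2
  rw [← h1, ← h2, hsymm, hsymm, ← two_mul, ← two_mul] at h
  have h3 := (ENNReal.mul_le_mul_iff_right (by simp) (by simp)).1 h
  exact (ENNReal.mul_le_mul_iff_right (by simp) (by simp)).1 h3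

end Rearrangement

lemma one_sub_norm_sq_pos {E : Type*} [NormedAddCommGroup E] {O : E} (hO : ‖O‖ < 1) :
    0 < 1 - ‖O‖ ^ 2 := by
  nlinarith [norm_nonneg O]

section Tilt

variable {E : Type*} [NormedAddCommGroup E] [InnerProductSpace ℝ E]

/-- The square root of the discriminant in the equation for `tiltRadius`. -/
noncomputable def tiltDiscr (O w : E) : ℝ := √(inner ℝ w O ^ 2 + (1 - ‖O‖ ^ 2) * ‖w‖ ^ 2)

/-- The solution `s ≥ 0` of `‖w + s • O‖ = s`, where `‖O‖ < 1`. -/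
noncomputable def tiltRadius (O w : E) : ℝ := (inner ℝ w O + tiltDiscr O w) / (1 - ‖O‖ ^ 2)

lemma tiltDiscr_sub_norm_smul {O : E} (hO : ‖O‖ < 1) (z : E) :
    tiltDiscr O (z - ‖z‖ • O) = ‖z‖ - inner ℝ z O := by
  have h1 : inner ℝ (z - ‖z‖ • O) O = inner ℝ z O - ‖z‖ * ‖O‖ ^ 2 := by
    rw [inner_sub_left, real_inner_smul_left, real_inner_self_eq_norm_sq]
  have h2 : ‖z - ‖z‖ • O‖ ^ 2 = ‖z‖ ^ 2 - 2 * (‖z‖ * inner ℝ z O) + ‖z‖ ^ 2 * ‖O‖ ^ 2 := by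
    rw [norm_sub_sq_real, real_inner_smul_right, norm_smul, norm_norm, mul_pow]
  have h3 : inner ℝ z O ≤ ‖z‖ := (real_inner_le_norm z O).trans
    (mul_le_of_le_one_right (norm_nonneg z) hO.le)
  rw [tiltDiscr, h1, h2, ← Real.sqrt_sq (sub_nonneg.2 h3)]
  congr 1
  ring

lemma tiltRadius_sub_norm_smul {O : E} (hO : ‖O‖ < 1) (z : E) :
    tiltRadius O (z - ‖z‖ • O) = ‖z‖ := by
  rw [tiltRadius, tiltDiscr_sub_norm_smul hO, inner_sub_left, real_inner_smul_left,
    real_inner_self_eq_norm_sq, div_eq_iff (one_sub_norm_sq_pos hO).ne']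
  ring

lemma sq_tiltDiscr {O : E} (hO : ‖O‖ < 1) (w : E) :
    tiltDiscr O w ^ 2 = inner ℝ w O ^ 2 + (1 - ‖O‖ ^ 2) * ‖w‖ ^ 2 :=
  Real.sq_sqrt (by have := one_sub_norm_sq_pos hO; positivity)

lemma abs_inner_le_tiltDiscr {O : E} (hO : ‖O‖ < 1) (w : E) : |inner ℝ w O| ≤ tiltDiscr O w :=
  Real.abs_le_sqrt (le_add_of_nonneg_right (by have := one_sub_norm_sq_pos hO; positivity))

lemma norm_add_tiltRadius_smul {O : E} (hO : ‖O‖ < 1) (w : E) :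
    ‖w + tiltRadius O w • O‖ = tiltRadius O w := by
  have hb := one_sub_norm_sq_pos hO
  have h0 : 0 ≤ tiltRadius O w :=
    div_nonneg (by linarith [neg_le_of_abs_le (abs_inner_le_tiltDiscr hO w)]) hb.le
  rw [← sq_eq_sq₀ (norm_nonneg _) h0, norm_add_sq_real, norm_smul, mul_pow, Real.norm_eq_abs, sq_abs,
    real_inner_smul_right]
  have h1 : (1 - ‖O‖ ^ 2) * tiltRadius O w - inner ℝ w O = tiltDiscr O w := by
    rw [tiltRadius]
    field_simp
    ring
  have h2 := sq_tiltDiscr hO w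
  rw [← h1] at h2
  have h3 : (1 - ‖O‖ ^ 2) * (‖w‖ ^ 2 + 2 * (tiltRadius O w * inner ℝ w O)
      + tiltRadius O w ^ 2 * ‖O‖ ^ 2 - tiltRadius O w ^ 2) = 0 := by linear_combination -h2
  rcases mul_eq_zero.1 h3 with h | h
  · exact absurd h hb.ne'
  · linarith

lemma image_sub_norm_smul {O : E} (hO : ‖O‖ < 1) :
    (fun z : E => z - ‖z‖ • O) '' {0}ᶜ = {0}ᶜ := by
  ext w
  simp only [mem_image, mem_compl_iff, mem_singleton_iff]
  constructor
  · rintro ⟨z, hz, rfl⟩ h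
    have h1 : tiltRadius O (z - ‖z‖ • O) = 0 := by rw [h]; simp [tiltRadius, tiltDiscr]
    rw [tiltRadius_sub_norm_smul hO] at h1
    exact hz (norm_eq_zero.1 h1)
  · intro hw
    refine ⟨w + tiltRadius O w • O, fun h => hw ?_, ?_⟩
    · have h1 := norm_add_tiltRadius_smul hO w
      rw [h, norm_zero] at h1
      simpa [← h1] using h
    · rw [norm_add_tiltRadius_smul hO]
      simp

lemma injective_sub_norm_smul {O : E} (hO : ‖O‖ < 1) :
    Function.Injective (fun z : E => z - ‖z‖ • O) := fun z z' h => by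
  have h1 : ‖z‖ = ‖z'‖ := by
    rw [← tiltRadius_sub_norm_smul hO z, ← tiltRadius_sub_norm_smul hO z']
    exact congrArg _ h
  simpa [h1] using h

lemma hasFDerivAt_sub_norm_smul (O : E) {z : E} (hz : z ≠ 0) :
    HasFDerivAt (fun z : E => z - ‖z‖ • O)
      (ContinuousLinearMap.id ℝ E - (‖z‖⁻¹ • innerSL ℝ z).smulRight O) z := by
  have h1 : HasFDerivAt (fun z : E => ‖z‖) (‖z‖⁻¹ • innerSL ℝ z) z := by
    have h2 : HasFDerivAt (fun z : E => √(‖z‖ ^ 2)) _ z :=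
      ((hasStrictFDerivAt_norm_sq z).hasFDerivAt).sqrt (by positivity)
    simp only [Real.sqrt_sq (norm_nonneg _)] at h2
    refine h2.congr_fderiv ?_
    ext v
    simp
    field_simp
  exact (hasFDerivAt_id z).sub (h1.smul_const O)

lemma det_id_sub_smulRight [FiniteDimensional ℝ E] (f : E →L[ℝ] ℝ) (O : E) :
    (ContinuousLinearMap.id ℝ E - f.smulRight O).det = 1 - f O := by
  have h := LinearMap.transvection.det (R := ℝ) (V := E) (f : E →ₗ[ℝ] ℝ) (-O)
  have h2 : ((ContinuousLinearMap.id ℝ E - f.smulRight O : E →L[ℝ] E) : E →ₗ[ℝ] E)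
      = LinearMap.transvection (f : E →ₗ[ℝ] ℝ) (-O) := by
    ext v
    simp [LinearMap.transvection.apply, sub_eq_add_neg]
  rw [ContinuousLinearMap.det, h2, h]
  simp [sub_eq_add_neg]

end Tilt

section TiltWeight

variable {E : Type*} [NormedAddCommGroup E] [InnerProductSpace ℝ E]

/-- The weight produced by pushing the Poisson-type kernel forward under `z ↦ z - ‖z‖ • κ • x`. -/
noncomputable def tiltWeight (m : ℕ) (lam κ : ℝ) (x w : E) : ℝ :=
  ‖w‖ ^ m * (tiltRadius (κ • x) w ^ 2)⁻¹ *
    (‖w - (tiltRadius (κ • x) w * (1 - κ)) • x‖ ^ 2) ^ (-lam) / tiltDiscr (κ • x) w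

lemma norm_smul_lt_one {κ : ℝ} {x : E} (hκ0 : 0 ≤ κ) (hκ1 : κ ≤ 1) (hx : ‖x‖ < 1) : ‖κ • x‖ < 1 := by
  rw [norm_smul, Real.norm_eq_abs, abs_of_nonneg hκ0]
  exact (mul_le_of_le_one_left (norm_nonneg x) hκ1).trans_lt hx

/-- The hyperbolic angle of `w` relative to `κ • x`. -/
noncomputable def tiltAngle (κ : ℝ) (x w : E) : ℝ :=
  Real.arsinh (κ * inner ℝ w x / (√(1 - ‖κ • x‖ ^ 2) * ‖w‖))

lemma tiltDiscr_eq_cosh {κ : ℝ} {x w : E} (hO : ‖κ • x‖ < 1) (hw : w ≠ 0) :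
    tiltDiscr (κ • x) w = √(1 - ‖κ • x‖ ^ 2) * ‖w‖ * Real.cosh (tiltAngle κ x w) := by
  have hb := one_sub_norm_sq_pos hO
  have hβ : 0 < √(1 - ‖κ • x‖ ^ 2) * ‖w‖ := by positivity
  rw [tiltAngle, Real.cosh_arsinh, tiltDiscr, Real.sqrt_eq_iff_mul_self_eq_of_pos (by positivity),
    mul_mul_mul_comm, Real.mul_self_sqrt (by positivity), real_inner_smul_right, div_pow, mul_pow,
    mul_mul_mul_comm, Real.mul_self_sqrt hb.le, mul_pow, Real.sq_sqrt hb.le]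
  field_simp
  ring

lemma inner_eq_sinh {κ : ℝ} {x w : E} (hO : ‖κ • x‖ < 1) (hw : w ≠ 0) :
    κ * inner ℝ w x = √(1 - ‖κ • x‖ ^ 2) * ‖w‖ * Real.sinh (tiltAngle κ x w) := by
  have hb := one_sub_norm_sq_pos hO
  have hβ : 0 < √(1 - ‖κ • x‖ ^ 2) * ‖w‖ := by positivity
  rw [tiltAngle, Real.sinh_arsinh]
  field_simp

lemma tiltRadius_eq_exp {κ : ℝ} {x w : E} (hO : ‖κ • x‖ < 1) (hw : w ≠ 0) :
    tiltRadius (κ • x) w = ‖w‖ / √(1 - ‖κ • x‖ ^ 2) * Real.exp (tiltAngle κ x w) := by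
  have hb := one_sub_norm_sq_pos hO
  have hβ : 0 < √(1 - ‖κ • x‖ ^ 2) := by positivity
  rw [tiltRadius, tiltDiscr_eq_cosh hO hw, real_inner_smul_right, inner_eq_sinh hO hw,
    ← Real.cosh_add_sinh, div_eq_iff hb.ne']
  have hs := Real.sq_sqrt hb.le
  generalize √(1 - ‖κ • x‖ ^ 2) = β at *
  rw [← hs]
  field_simp
  ring

/-- The parameter of `hypProfile` attached to `κ` and `r`. -/
noncomputable def tiltGamma (κ r : ℝ) : ℝ :=
  2 * (1 - κ ^ 2 * r ^ 2) / (κ * (1 + r ^ 2 - 2 * κ * r ^ 2)) - 1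

lemma tiltGamma_denom_pos {κ r : ℝ} (hκ1 : κ < 1) (hr0 : 0 ≤ r) (hr : r < 1) :
    0 < 1 + r ^ 2 - 2 * κ * r ^ 2 := by nlinarith [sq_nonneg r]

lemma norm_sub_tiltRadius_sq {κ : ℝ} {x w : E} (hκ0 : 0 < κ) (hκ1 : κ < 1) (hx : ‖x‖ < 1)
    (hw : w ≠ 0) :
    ‖w - (tiltRadius (κ • x) w * (1 - κ)) • x‖ ^ 2
      = ‖w‖ ^ 2 * ((1 + ‖x‖ ^ 2 - 2 * κ * ‖x‖ ^ 2) / (1 - ‖κ • x‖ ^ 2)) *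
        (Real.exp (tiltAngle κ x w) *
          (Real.cosh (tiltAngle κ x w) - tiltGamma κ ‖x‖ * Real.sinh (tiltAngle κ x w))) := by
  have hO := norm_smul_lt_one hκ0.le hκ1.le hx
  have hb := one_sub_norm_sq_pos hO
  have hL := tiltGamma_denom_pos hκ1 (norm_nonneg x) hx
  have h1 := inner_eq_sinh hO hw
  have h2 : inner ℝ w x = (√(1 - ‖κ • x‖ ^ 2) * ‖w‖ * Real.sinh (tiltAngle κ x w)) / κ := by
    rw [← h1]
    field_simp
  have h3 : ‖κ • x‖ ^ 2 = κ ^ 2 * ‖x‖ ^ 2 := by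
    rw [norm_smul, mul_pow, Real.norm_eq_abs, sq_abs]
  have hβ : 0 < √(1 - ‖κ • x‖ ^ 2) := by positivity
  have hβ2 : √(1 - ‖κ • x‖ ^ 2) ^ 2 = 1 - κ ^ 2 * ‖x‖ ^ 2 := by rw [Real.sq_sqrt hb.le, h3]
  rw [norm_sub_sq_real, real_inner_smul_right, norm_smul, mul_pow, Real.norm_eq_abs, sq_abs, h2,
    tiltRadius_eq_exp hO hw, tiltGamma, ← Real.sq_sqrt hb.le, Real.sqrt_sq hβ.le]
  rw [← Real.cosh_add_sinh]
  have hcs := Real.cosh_sq (tiltAngle κ x w)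
  generalize Real.cosh (tiltAngle κ x w) = C at *
  generalize Real.sinh (tiltAngle κ x w) = S at *
  generalize √(1 - ‖κ • x‖ ^ 2) = β at *
  generalize ‖x‖ = r at *
  rw [← hβ2]
  field_simp
  have hr2 : r ^ 2 * κ ^ 2 = 1 - β ^ 2 := by rw [hβ2]; ring
  linear_combination (C + S) ^ 2 * κ * hr2 - κ * β ^ 2 * hcs

lemma cosh_sub_tiltGamma_mul_sinh_pos {κ : ℝ} {x w : E} (hκ0 : 0 < κ) (hκ1 : κ < 1) (hx : ‖x‖ < 1)
    (hw : w ≠ 0) :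
    0 < Real.cosh (tiltAngle κ x w) - tiltGamma κ ‖x‖ * Real.sinh (tiltAngle κ x w) := by
  have hO := norm_smul_lt_one hκ0.le hκ1.le hx
  have hb := one_sub_norm_sq_pos hO
  have hL := tiltGamma_denom_pos hκ1 (norm_nonneg x) hx
  have hwn : 0 < ‖w‖ := norm_pos_iff.2 hw
  have hs : 0 < tiltRadius (κ • x) w := by rw [tiltRadius_eq_exp hO hw]; positivity
  have h1 : w - (tiltRadius (κ • x) w * (1 - κ)) • x
      = (w + tiltRadius (κ • x) w • κ • x) - tiltRadius (κ • x) w • x := by module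
  have h2 : 0 < ‖w - (tiltRadius (κ • x) w * (1 - κ)) • x‖ := by
    rw [h1]
    refine lt_of_lt_of_le ?_ (norm_sub_norm_le _ _)
    rw [norm_add_tiltRadius_smul hO, norm_smul, Real.norm_eq_abs, abs_of_pos hs]
    nlinarith
  have h3 := pow_pos h2 2
  rw [norm_sub_tiltRadius_sq hκ0 hκ1 hx hw] at h3
  exact pos_of_mul_pos_right (pos_of_mul_pos_right h3 (by positivity)) (Real.exp_pos _).le

lemma tiltWeight_eq {m : ℕ} {lam κ : ℝ} {x w : E} (hκ0 : 0 < κ) (hκ1 : κ < 1) (hx : ‖x‖ < 1)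
    (hw : w ≠ 0) :
    tiltWeight m lam κ x w = ‖w‖ ^ m * ((‖w‖ / √(1 - ‖κ • x‖ ^ 2)) ^ 2)⁻¹ *
      (‖w‖ ^ 2 * ((1 + ‖x‖ ^ 2 - 2 * κ * ‖x‖ ^ 2) / (1 - ‖κ • x‖ ^ 2))) ^ (-lam) /
      (√(1 - ‖κ • x‖ ^ 2) * ‖w‖) * hypProfile lam (tiltGamma κ ‖x‖) (tiltAngle κ x w) := by
  have hO := norm_smul_lt_one hκ0.le hκ1.le hx
  have hb := one_sub_norm_sq_pos hO
  have hL := tiltGamma_denom_pos hκ1 (norm_nonneg x) hx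
  have hp := cosh_sub_tiltGamma_mul_sinh_pos hκ0 hκ1 hx hw
  have hwn : 0 < ‖w‖ := norm_pos_iff.2 hw
  rw [tiltWeight, norm_sub_tiltRadius_sq hκ0 hκ1 hx hw, tiltDiscr_eq_cosh hO hw,
    tiltRadius_eq_exp hO hw, hypProfile, Real.mul_rpow (by positivity) (by positivity),
    Real.mul_rpow (Real.exp_pos _).le hp.le, ← Real.exp_mul, mul_pow, mul_inv]
  generalize tiltAngle κ x w = t
  have h1 : Real.exp (-(lam + 2) * t) = (Real.exp t ^ 2)⁻¹ * Real.exp (t * -lam) := by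
    rw [← Real.exp_nat_mul, ← Real.exp_neg, ← Real.exp_add]
    congr 1
    push_cast
    ring
  rw [h1]
  field_simp

lemma tiltGamma_bounds {κ r lam : ℝ} (hκ : κ * (lam + 1) = lam) (hlam : 0 < lam) (hr0 : 0 ≤ r)
    (hr : r < 1) : lam + 1 ≤ lam * tiltGamma κ r ∧ lam * tiltGamma κ r ≤ lam + 2 := by
  have hκ0 : 0 < κ := by
    by_contra! h
    nlinarith
  have hκ1 : κ < 1 := by
    by_contra! h
    nlinarith
  have hL := tiltGamma_denom_pos hκ1 hr0 hr
  have h1 : lam * tiltGamma κ r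
      = 2 * (lam + 1) * ((1 - κ ^ 2 * r ^ 2) / (1 + r ^ 2 - 2 * κ * r ^ 2)) - lam := by
    rw [tiltGamma]
    nth_rw 1 [← hκ]
    field_simp
    linear_combination -hκ
  rw [h1]
  constructor
  · have h2 : (1 + κ) / 2 ≤ (1 - κ ^ 2 * r ^ 2) / (1 + r ^ 2 - 2 * κ * r ^ 2) := by
      rw [div_le_div_iff₀ two_pos hL]
      nlinarith [mul_nonneg (sub_nonneg.2 hκ1.le) (sub_nonneg.2 (show r ^ 2 ≤ 1 by nlinarith))]
    nlinarith
  · have h2 : (1 - κ ^ 2 * r ^ 2) / (1 + r ^ 2 - 2 * κ * r ^ 2) ≤ 1 := by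
      rw [div_le_one hL]
      nlinarith [sq_nonneg (r * (1 - κ))]
    nlinarith

lemma hypProfile_abs_add_neg (lam γ t : ℝ) :
    hypProfile lam γ |t| + hypProfile lam γ (-|t|) = hypProfile lam γ t + hypProfile lam γ (-t) := by
  rcases abs_choice t with h | h <;> rw [h]
  rw [neg_neg, add_comm]

lemma tiltAngle_neg (κ : ℝ) (x w : E) : tiltAngle κ x (-w) = -tiltAngle κ x w := by
  simp [tiltAngle, ← Real.arsinh_neg, neg_div]

lemma abs_arsinh (t : ℝ) : |Real.arsinh t| = Real.arsinh |t| := by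
  rcases le_total 0 t with h | h
  · rw [abs_of_nonneg h, abs_of_nonneg (Real.arsinh_nonneg_iff.2 h)]
  · rw [abs_of_nonpos h, abs_of_nonpos (Real.arsinh_nonpos_iff.2 h), Real.arsinh_neg]

lemma abs_tiltAngle_le {κ : ℝ} {x w w' : E} (hw : ‖w‖ = ‖w'‖)
    (h : |inner ℝ w x| ≤ |inner ℝ w' x|) : |tiltAngle κ x w| ≤ |tiltAngle κ x w'| := by
  rw [tiltAngle, tiltAngle, abs_arsinh, abs_arsinh, Real.arsinh_le_arsinh, abs_div, abs_div, hw,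
    abs_mul κ, abs_mul κ]
  gcongr

lemma tiltWeight_add_neg_mono {m : ℕ} {κ lam : ℝ} {x w w' : E} (hκ : κ * (lam + 1) = lam) (hlam : 0 < lam)
    (hx : ‖x‖ < 1) (hw : ‖w‖ = ‖w'‖) (h : |inner ℝ w x| ≤ |inner ℝ w' x|) :
    tiltWeight m lam κ x w + tiltWeight m lam κ x (-w)
      ≤ tiltWeight m lam κ x w' + tiltWeight m lam κ x (-w') := by
  have hκ0 : 0 < κ := by
    by_contra! h
    nlinarith
  have hκ1 : κ < 1 := by
    by_contra! h
    nlinarith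
  rcases eq_or_ne w 0 with rfl | hw0
  · rw [norm_zero, eq_comm, norm_eq_zero] at hw
    rw [hw]
  have hw0' : w' ≠ 0 := by rwa [← norm_ne_zero_iff, ← hw, norm_ne_zero_iff]
  have hb := one_sub_norm_sq_pos (norm_smul_lt_one hκ0.le hκ1.le hx)
  have hL := tiltGamma_denom_pos hκ1 (norm_nonneg x) hx
  obtain ⟨h1, h2⟩ := tiltGamma_bounds hκ hlam (norm_nonneg x) hx
  rw [tiltWeight_eq hκ0 hκ1 hx hw0, tiltWeight_eq hκ0 hκ1 hx hw0',
    tiltWeight_eq hκ0 hκ1 hx (neg_ne_zero.2 hw0), tiltWeight_eq hκ0 hκ1 hx (neg_ne_zero.2 hw0'),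
    norm_neg, norm_neg, hw, tiltAngle_neg, tiltAngle_neg, ← mul_add, ← mul_add,
    ← hypProfile_abs_add_neg _ _ (tiltAngle κ x w), ← hypProfile_abs_add_neg _ _ (tiltAngle κ x w')]
  refine mul_le_mul_of_nonneg_left (hypProfile_add_neg_mono hlam h1 h2 (abs_nonneg _)
    (abs_tiltAngle_le hw h) ?_) (by positivity)
  rcases abs_choice (tiltAngle κ x w') with h | h
  · rw [h]
    exact cosh_sub_tiltGamma_mul_sinh_pos hκ0 hκ1 hx hw0'
  · rw [h, ← tiltAngle_neg]
    exact cosh_sub_tiltGamma_mul_sinh_pos hκ0 hκ1 hx (neg_ne_zero.2 hw0')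

lemma tiltWeight_nonneg {m : ℕ} {lam κ : ℝ} (x w : E) : 0 ≤ tiltWeight m lam κ x w := by
  have : 0 ≤ tiltDiscr (κ • x) w := Real.sqrt_nonneg _
  unfold tiltWeight
  positivity

end TiltWeight

section TiltIntegral

variable {E : Type*} [NormedAddCommGroup E] [InnerProductSpace ℝ E]

lemma sq_rpow_neg {s lam : ℝ} {d : ℕ} (hs : 0 < s) (hd : 2 * lam + 2 = d) :
    (s ^ 2) ^ (-lam) = s ^ 2 / s ^ d := by
  have h : -lam = 1 - (d : ℝ) / 2 := by linarith
  rw [h, Real.rpow_sub (by positivity), Real.rpow_one, ← Real.rpow_natCast s 2, ← Real.rpow_mul hs.le,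
    ← Real.rpow_natCast s d]
  congr 2
  push_cast
  ring

lemma lintegral_Ioo_ofReal_pow {a : ℝ} (ha : 0 ≤ a) (d : ℕ) :
    ∫⁻ s in Ioo 0 a, ENNReal.ofReal (s ^ d) = ENNReal.ofReal (a ^ (d + 1) / (d + 1)) := by
  rw [← ofReal_integral_eq_lintegral_ofReal, ← integral_Ioc_eq_integral_Ioo,
    ← intervalIntegral.integral_of_le ha, integral_pow]
  · simp
  · exact (Continuous.integrableOn_Icc (by fun_prop)).mono_set Ioo_subset_Icc_self
  · exact (ae_restrict_iff' measurableSet_Ioo).2 (Eventually.of_forall fun s hs => pow_nonneg hs.1.le _)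

lemma det_mul_tiltWeight {d : ℕ} {lam κ : ℝ} {x z : E} (hd : 2 * lam + 2 = d) (hO : ‖κ • x‖ < 1)
    (hz : z ≠ 0) :
    (1 - ‖z‖⁻¹ * inner ℝ z (κ • x)) * tiltWeight (d + 1) lam κ x (z - ‖z‖ • κ • x)
      = (‖z - ‖z‖ • κ • x‖ / ‖z‖) ^ (d + 1) * (‖x - ‖z‖⁻¹ • z‖ ^ 2) ^ (-lam) := by
  have hzn : 0 < ‖z‖ := norm_pos_iff.2 hz
  have h1 : z - ‖z‖ • κ • x - (‖z‖ * (1 - κ)) • x = -(‖z‖ • (x - ‖z‖⁻¹ • z)) := by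
    have h0 : ‖z‖ • ‖z‖⁻¹ • z = z := smul_inv_smul₀ hzn.ne' z
    rw [smul_sub, h0]
    module
  have h2 : 0 < ‖z‖ - inner ℝ z (κ • x) := by
    nlinarith [real_inner_le_norm z (κ • x)]
  rw [tiltWeight, tiltRadius_sub_norm_smul hO, tiltDiscr_sub_norm_smul hO, h1, norm_neg, norm_smul,
    norm_norm, mul_pow, Real.mul_rpow (by positivity) (by positivity), sq_rpow_neg hzn hd]
  generalize inner ℝ z (κ • x) = q at *
  generalize ‖z - ‖z‖ • κ • x‖ = w
  generalize ‖x - ‖z‖⁻¹ • z‖ = v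
  rw [div_pow]
  field_simp
  ring

variable [FiniteDimensional ℝ E] [MeasurableSpace E] [BorelSpace E]

lemma measurable_tiltWeight (m : ℕ) (lam κ : ℝ) (x : E) : Measurable (tiltWeight m lam κ x) := by
  unfold tiltWeight tiltRadius tiltDiscr
  fun_prop

/-- The kernel integral over the sphere as a weighted integral of `|⟪w, l⟫|` over the ball. -/
lemma lintegral_sphere_eq_lintegral_tiltWeight [Nontrivial E] {lam κ : ℝ} {x : E}
    (hd : 2 * lam + 2 = Module.finrank ℝ E) (hO : ‖κ • x‖ < 1) (l : E) :
    (∫⁻ η : sphere (0 : E) 1, ENNReal.ofReal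
      (|inner ℝ ((η : E) - κ • x) l| * (‖x - η‖ ^ 2) ^ (-lam)) ∂(volume : Measure E).toSphere)
        * ENNReal.ofReal (1 / (Module.finrank ℝ E + 1))
      = ∫⁻ w : E, ENNReal.ofReal |inner ℝ w l| * (ball (0 : E) 1).indicator (fun w =>
          ENNReal.ofReal (tiltWeight (Module.finrank ℝ E + 1) lam κ x w)) w := by
  obtain ⟨d, hdd⟩ : ∃ d, d = Module.finrank ℝ E := ⟨_, rfl⟩
  rw [← hdd] at hd ⊢
  have hd0 : 0 < d := hdd ▸ Module.finrank_pos
  set g : E → ℝ≥0∞ := fun w => ENNReal.ofReal |inner ℝ w l| * (ball (0 : E) 1).indicator (fun w =>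
          ENNReal.ofReal (tiltWeight (d + 1) lam κ x w)) w with hg
  set T : E → E := fun z => z - ‖z‖ • κ • x with hT
  have hTm : Measurable T := by fun_prop
  set H : E → ℝ≥0∞ := fun z => (T ⁻¹' ball 0 1).indicator (fun z => ENNReal.ofReal
    (|inner ℝ (T z) l| * (‖T z‖ / ‖z‖) ^ (d + 1) * (‖x - ‖z‖⁻¹ • z‖ ^ 2) ^ (-lam))) z with hH
  have hHm : Measurable H := by
    refine Measurable.indicator ?_ (hTm measurableSet_ball)
    fun_prop
  have h1 : ∫⁻ w, g w = ∫⁻ z, H z := by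
    rw [← restrict_compl_singleton (μ := (volume : Measure E)) (0 : E)]
    nth_rw 1 [← image_sub_norm_smul hO]
    rw [lintegral_image_eq_lintegral_abs_det_fderiv_mul volume (measurableSet_singleton 0).compl
      (fun z hz => (hasFDerivAt_sub_norm_smul (κ • x) hz).hasFDerivWithinAt)
      (injective_sub_norm_smul hO).injOn]
    refine setLIntegral_congr_fun (measurableSet_singleton 0).compl fun z hz => ?_
    have hz0 : z ≠ 0 := hz
    simp only [hg, hH]
    by_cases hb : T z ∈ ball (0 : E) 1
    · rw [indicator_of_mem hb, indicator_of_mem (show z ∈ T ⁻¹' ball 0 1 from hb)]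
      have h2 : 0 ≤ 1 - ‖z‖⁻¹ * inner ℝ z (κ • x) := by
        have hzn : 0 < ‖z‖ := norm_pos_iff.2 hz0
        rw [sub_nonneg, inv_mul_le_iff₀ hzn]
        nlinarith [real_inner_le_norm z (κ • x)]
      rw [det_id_sub_smulRight, ← ENNReal.ofReal_mul (abs_nonneg _),
        ← ENNReal.ofReal_mul (abs_nonneg _)]
      congr 1
      rw [mul_assoc, ← det_mul_tiltWeight hd hO hz0]
      simp only [smul_apply, innerSL_apply_apply, smul_eq_mul]
      rw [abs_of_nonneg h2]
      ring
    · rw [indicator_of_notMem hb, indicator_of_notMem (show z ∉ T ⁻¹' ball 0 1 from hb)]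
      simp
  rw [h1, lintegral_eq_lintegral_toSphere volume hHm, ← lintegral_mul_const' _ _ ENNReal.ofReal_ne_top]
  refine lintegral_congr fun η => ?_
  have hη : ‖(η : E)‖ = 1 := by simp
  set ρ := ‖(η : E) - κ • x‖ with hρ
  have hρ0 : 0 < ρ := by
    refine lt_of_lt_of_le ?_ (norm_sub_norm_le _ _)
    rw [hη]
    linarith
  set c := |inner ℝ ((η : E) - κ • x) l| * (‖x - η‖ ^ 2) ^ (-lam) with hc
  have hc0 : 0 ≤ c := by positivity
  have h3 : ∀ s ∈ Ioi (0 : ℝ), ENNReal.ofReal (s ^ (Module.finrank ℝ E - 1)) * H (s • (η : E))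
      = (Ioo 0 ρ⁻¹).indicator (fun s => ENNReal.ofReal (s ^ d) * ENNReal.ofReal (c * ρ ^ (d + 1))) s :=
    fun s hs => by
      have hs0 : 0 < s := hs
      have hn : ‖s • (η : E)‖ = s := by rw [norm_smul, hη, Real.norm_eq_abs, abs_of_pos hs0, mul_one]
      have hTs : T (s • (η : E)) = s • ((η : E) - κ • x) := by
        simp only [hT]
        rw [hn, smul_sub]
      have hTn : ‖T (s • (η : E))‖ = s * ρ := by rw [hTs, norm_smul, Real.norm_eq_abs, abs_of_pos hs0]
      have hiff : s • (η : E) ∈ T ⁻¹' ball 0 1 ↔ s ∈ Ioo 0 ρ⁻¹ := by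
        rw [mem_preimage, mem_ball_zero_iff, hTn, mem_Ioo, lt_inv_comm₀ hs0 hρ0]
        rw [← lt_div_iff₀' hs0, one_div]
        simp [hs0]
      by_cases hm : s ∈ Ioo 0 ρ⁻¹
      · rw [indicator_of_mem hm, hH]
        simp only
        rw [indicator_of_mem (hiff.2 hm), ← ENNReal.ofReal_mul (by positivity),
          ← ENNReal.ofReal_mul (by positivity), hTn, hn, hTs, real_inner_smul_left, abs_mul,
          abs_of_pos hs0, smul_smul, inv_mul_cancel₀ hs0.ne', one_smul, ← hdd, hc,
          mul_div_cancel_left₀ _ hs0.ne']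
        congr 1
        obtain ⟨k, rfl⟩ : ∃ k, d = k + 1 := ⟨d - 1, by omega⟩
        rw [Nat.add_sub_cancel]
        ring
      · rw [indicator_of_notMem hm, hH]
        simp only
        rw [indicator_of_notMem (fun h => hm (hiff.1 h)), mul_zero]
  rw [setLIntegral_congr_fun measurableSet_Ioi h3, lintegral_indicator measurableSet_Ioo,
    Measure.restrict_restrict measurableSet_Ioo, inter_eq_left.2 Ioo_subset_Ioi_self,
    lintegral_mul_const' _ _ ENNReal.ofReal_ne_top, lintegral_Ioo_ofReal_pow (by positivity),
    ← ENNReal.ofReal_mul (by positivity), ← ENNReal.ofReal_mul (by positivity)]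
  congr 1
  field_simp
  rw [mul_assoc, ← mul_pow, one_div_mul_cancel hρ0.ne', one_pow, mul_one]

/-- Among all directions `l`, the kernel integral is largest in the radial direction. -/
lemma lintegral_sphere_le [Nontrivial E] {lam κ : ℝ} {x e l : E} {r : ℝ}
    (hd : 2 * lam + 2 = Module.finrank ℝ E) (hlam : 0 < lam) (hκ : κ * (lam + 1) = lam) (hx : ‖x‖ < 1)
    (hxe : x = r • e) (he : ‖e‖ = 1) (hl : ‖l‖ = 1) :
    ∫⁻ η : sphere (0 : E) 1, ENNReal.ofReal
      (|inner ℝ ((η : E) - κ • x) l| * (‖x - η‖ ^ 2) ^ (-lam)) ∂(volume : Measure E).toSphere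
    ≤ ∫⁻ η : sphere (0 : E) 1, ENNReal.ofReal
      (|inner ℝ ((η : E) - κ • x) e| * (‖x - η‖ ^ 2) ^ (-lam)) ∂(volume : Measure E).toSphere := by
  have hκ0 : 0 < κ := by
    by_contra! h
    nlinarith
  have hκ1 : κ < 1 := by
    by_contra! h
    nlinarith
  have hO := norm_smul_lt_one hκ0.le hκ1.le hx
  have hc : ENNReal.ofReal (1 / ((Module.finrank ℝ E : ℝ) + 1)) ≠ 0 := by
    rw [Ne, ENNReal.ofReal_eq_zero, not_le]
    positivity
  rw [← ENNReal.mul_le_mul_iff_left hc ENNReal.ofReal_ne_top,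
    lintegral_sphere_eq_lintegral_tiltWeight hd hO, lintegral_sphere_eq_lintegral_tiltWeight hd hO]
  refine lintegral_abs_inner_mul_le ?_ he hl fun w w' hw h => ?_
  · exact (ENNReal.measurable_ofReal.comp (measurable_tiltWeight _ _ _ _)).indicator measurableSet_ball
  · have h2 : |inner ℝ w x| ≤ |inner ℝ w' x| := by
      rw [hxe, real_inner_smul_right, real_inner_smul_right, abs_mul, abs_mul]
      gcongr
    have h3 := tiltWeight_add_neg_mono (m := Module.finrank ℝ E + 1) hκ hlam hx hw h2
    by_cases hb : ‖w‖ < 1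
    · have hb' : ‖w'‖ < 1 := hw ▸ hb
      rw [indicator_of_mem (by simpa using hb), indicator_of_mem (by simpa using hb),
        indicator_of_mem (by simpa using hb'), indicator_of_mem (by simpa using hb'),
        ← ENNReal.ofReal_add (tiltWeight_nonneg _ _) (tiltWeight_nonneg _ _),
        ← ENNReal.ofReal_add (tiltWeight_nonneg _ _) (tiltWeight_nonneg _ _)]
      exact ENNReal.ofReal_le_ofReal h3
    · rw [indicator_of_notMem (by simpa using hb), indicator_of_notMem (by simpa using hb)]
      simp

end TiltIntegral

section Slicing

variable {m : ℕ}

lemma lintegral_coord_norm_eq {F : ℝ → ℝ → ℝ≥0∞} (hF : Measurable fun p : ℝ × ℝ => F p.1 p.2) :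
    ∫⁻ z : EuclideanSpace ℝ (Fin (m + 1)), F (z 0) ‖z‖
      = ∫⁻ a : ℝ, ∫⁻ y : EuclideanSpace ℝ (Fin m), F a √(a ^ 2 + ‖y‖ ^ 2) := by
  have hFm : Measurable fun z : EuclideanSpace ℝ (Fin (m + 1)) => F (z 0) ‖z‖ :=
    hF.comp (f := fun z : EuclideanSpace ℝ (Fin (m + 1)) => (z 0, ‖z‖)) (by fun_prop)
  have hFm' : Measurable fun z : Fin (m + 1) → ℝ => F (z 0) ‖WithLp.toLp 2 z‖ :=
    hFm.comp (PiLp.volume_preserving_toLp (Fin (m + 1))).measurable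
  have h2 : Measurable fun p : ℝ × (Fin m → ℝ) => F p.1 √(p.1 ^ 2 + ‖WithLp.toLp 2 p.2‖ ^ 2) := by
    refine hF.comp (f := fun p : ℝ × (Fin m → ℝ) => (p.1, √(p.1 ^ 2 + ‖WithLp.toLp 2 p.2‖ ^ 2))) ?_
    have : Measurable fun p : ℝ × (Fin m → ℝ) => WithLp.toLp 2 p.2 :=
      (PiLp.volume_preserving_toLp (Fin m)).measurable.comp measurable_snd
    fun_prop
  rw [← (PiLp.volume_preserving_toLp (Fin (m + 1))).lintegral_comp hFm]
  have h3 := (volume_preserving_piFinSuccAbove (fun _ : Fin (m + 1) => ℝ) 0).lintegral_comp h2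
  rw [Measure.volume_eq_prod, lintegral_prod _ h2.aemeasurable] at h3
  calc _ = _ := ?_
    _ = _ := h3
    _ = _ := ?_
  · refine lintegral_congr fun z => ?_
    congr 1
    rw [EuclideanSpace.norm_eq, Fin.sum_univ_succ, EuclideanSpace.norm_sq_eq]
    simp [MeasurableEquiv.piFinSuccAbove, Fin.insertNthEquiv, Fin.tail]
  · refine lintegral_congr fun a => ?_
    have h4 : Measurable fun y : EuclideanSpace ℝ (Fin m) => F a √(a ^ 2 + ‖y‖ ^ 2) :=
      hF.comp (f := fun y : EuclideanSpace ℝ (Fin m) => (a, √(a ^ 2 + ‖y‖ ^ 2))) (by fun_prop)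
    rw [← (PiLp.volume_preserving_toLp (Fin m)).lintegral_comp h4]

lemma lintegral_comp_sqrt_norm [NeZero m] {G : ℝ → ℝ≥0∞} (hG : Measurable G) :
    ∫⁻ y : EuclideanSpace ℝ (Fin m), G ‖y‖
      = (volume : Measure (EuclideanSpace ℝ (Fin m))).toSphere univ
        * ∫⁻ s in Ioi (0 : ℝ), ENNReal.ofReal (s ^ (m - 1)) * G s := by
  rw [lintegral_eq_lintegral_toSphere volume (f := fun y => G ‖y‖) (by fun_prop)]
  rw [mul_comm, ← lintegral_const]
  refine lintegral_congr fun η => setLIntegral_congr_fun measurableSet_Ioi fun s hs => ?_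
  have hη : ‖(η : EuclideanSpace ℝ (Fin m))‖ = 1 := by simp
  have hs0 : 0 < s := hs
  simp [norm_smul, hη, abs_of_pos hs0]

/-- Integration over `ℝ × (0, ∞)` in polar coordinates. -/
lemma lintegral_upper_half_plane {G : ℝ × ℝ → ℝ≥0∞} (hG : Measurable G) :
    ∫⁻ a : ℝ, ∫⁻ b in Ioi (0 : ℝ), G (a, b)
      = ∫⁻ s in Ioi (0 : ℝ), ∫⁻ θ in Ioo 0 π,
          ENNReal.ofReal s * G (s * Real.cos θ, s * Real.sin θ) := by
  have hS : MeasurableSet (univ ×ˢ Ioi (0 : ℝ) : Set (ℝ × ℝ)) :=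
    MeasurableSet.univ.prod measurableSet_Ioi
  have h1 : ∫⁻ a : ℝ, ∫⁻ b in Ioi (0 : ℝ), G (a, b)
      = ∫⁻ p : ℝ × ℝ, (univ ×ˢ Ioi (0 : ℝ) : Set (ℝ × ℝ)).indicator G p := by
    rw [lintegral_indicator hS, Measure.volume_eq_prod, ← Measure.prod_restrict,
      lintegral_prod _ hG.aemeasurable, Measure.restrict_univ]
  rw [h1, ← lintegral_comp_polarCoord_symm]
  have hm : Measurable fun p : ℝ × ℝ => ENNReal.ofReal p.1 •
      (univ ×ˢ Ioi (0 : ℝ) : Set (ℝ × ℝ)).indicator G (polarCoord.symm p) :=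
    Measurable.smul (ENNReal.measurable_ofReal.comp measurable_fst) ((hG.indicator hS).comp continuous_polarCoord_symm.measurable)
  rw [polarCoord_target, Measure.volume_eq_prod, ← Measure.prod_restrict,
      lintegral_prod _ hm.aemeasurable]
  refine setLIntegral_congr_fun measurableSet_Ioi fun s hs => ?_
  have hs0 : 0 < s := hs
  have h2 : ∀ θ ∈ Ioo (-π) π, ENNReal.ofReal s • (univ ×ˢ Ioi (0 : ℝ) : Set (ℝ × ℝ)).indicator G
      (polarCoord.symm (s, θ)) = (Ioo 0 π).indicator (fun θ =>
          ENNReal.ofReal s * G (s * Real.cos θ, s * Real.sin θ)) θ := fun θ hθ => by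
    rw [polarCoord_symm_apply, smul_eq_mul]
    simp only
    by_cases h : 0 < θ
    · have := mul_pos hs0 (Real.sin_pos_of_pos_of_lt_pi h hθ.2)
      rw [indicator_of_mem (show θ ∈ Ioo 0 π from ⟨h, hθ.2⟩), indicator_of_mem (show (s * Real.cos θ, s * Real.sin θ) ∈
        (univ ×ˢ Ioi (0 : ℝ) : Set (ℝ × ℝ)) from ⟨mem_univ _, this⟩)]
    · have := mul_nonpos_of_nonneg_of_nonpos hs0.le
        (Real.sin_nonpos_of_nonpos_of_neg_pi_le (not_lt.1 h) hθ.1.le)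
      rw [indicator_of_notMem (s := Ioo 0 π) (fun h' => h h'.1),
        indicator_of_notMem (fun h' => this.not_gt h'.2), mul_zero]
  rw [setLIntegral_congr_fun measurableSet_Ioo h2, lintegral_indicator measurableSet_Ioo,
    Measure.restrict_restrict measurableSet_Ioo, inter_eq_left.2]
  exact Ioo_subset_Ioo_left (by linarith [Real.pi_pos])

lemma lintegral_cos (f : ℝ → ℝ≥0∞) :
    ∫⁻ θ in Ioo 0 π, ENNReal.ofReal (Real.sin θ ^ m) * f (Real.cos θ)
      = ∫⁻ t in Ioo (-1 : ℝ) 1, ENNReal.ofReal ((1 - t ^ 2) ^ (((m : ℝ) - 1) / 2)) * f t := by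
  have himg : Real.cos '' Ioo 0 π = Ioo (-1) 1 := by
    ext t
    constructor
    · rintro ⟨θ, hθ, rfl⟩
      have h := Real.sin_pos_of_pos_of_lt_pi hθ.1 hθ.2
      have h' := Real.sin_sq_add_cos_sq θ
      constructor <;> nlinarith
    · intro ht
      refine ⟨Real.arccos t, ⟨Real.arccos_pos.2 ht.2, ?_⟩, Real.cos_arccos ht.1.le ht.2.le⟩
      refine lt_of_le_of_ne (Real.arccos_le_pi t) fun h => ?_
      rw [Real.arccos_eq_pi] at h
      linarith [ht.1]
  rw [← himg, lintegral_image_eq_lintegral_abs_deriv_mul measurableSet_Ioo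
    (fun θ _ => (Real.hasDerivAt_cos θ).hasDerivWithinAt)
    (Real.injOn_cos.mono Ioo_subset_Icc_self)]
  refine setLIntegral_congr_fun measurableSet_Ioo fun θ hθ => ?_
  have h := Real.sin_pos_of_pos_of_lt_pi hθ.1 hθ.2
  rw [← mul_assoc, ← ENNReal.ofReal_mul (abs_nonneg _), abs_neg, abs_of_pos h]
  congr 2
  rw [← Real.sin_sq, ← Real.rpow_natCast (Real.sin θ) 2, ← Real.rpow_mul h.le]
  nth_rw 2 [← Real.rpow_one (Real.sin θ)]
  rw [← Real.rpow_add h, ← Real.rpow_natCast]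
  congr 1
  push_cast
  ring

/-- Slicing of the sphere by hyperplanes orthogonal to a unit vector `e`. -/
lemma lintegral_sphere_inner [NeZero m] {f : ℝ → ℝ≥0∞} (hf : Measurable f)
    {e : EuclideanSpace ℝ (Fin (m + 1))} (he : ‖e‖ = 1) :
    ∫⁻ η : sphere (0 : EuclideanSpace ℝ (Fin (m + 1))) 1, f (inner ℝ (η : EuclideanSpace ℝ (Fin (m + 1))) e)
        ∂(volume : Measure (EuclideanSpace ℝ (Fin (m + 1)))).toSphere
      = (volume : Measure (EuclideanSpace ℝ (Fin m))).toSphere univ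
        * ∫⁻ t in Ioo (-1 : ℝ) 1, ENNReal.ofReal ((1 - t ^ 2) ^ (((m : ℝ) - 2) / 2)) * f t := by
  obtain ⟨k, rfl⟩ : ∃ k, m = k + 1 := ⟨m - 1, (Nat.succ_pred_eq_of_ne_zero (NeZero.ne m)).symm⟩
  obtain ⟨c, hc⟩ : ∃ c, c = ∫⁻ s in Ioo (0 : ℝ) 1, ENNReal.ofReal (s ^ (k + 1)) := ⟨_, rfl⟩
  have hc' : c = ENNReal.ofReal (1 / ((k : ℝ) + 2)) := by
    rw [hc, lintegral_Ioo_ofReal_pow zero_le_one]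
    congr 1
    push_cast
    ring
  have hc0 : c ≠ 0 := by
    rw [hc', Ne, ENNReal.ofReal_eq_zero, not_le]
    positivity
  have hct : c ≠ ∞ := hc' ▸ ENNReal.ofReal_ne_top
  have hF : Measurable fun p : ℝ × ℝ => (Ioo (0 : ℝ) 1).indicator (fun s => f (p.1 / s)) p.2 := by
    have : Measurable ((univ ×ˢ Ioo (0 : ℝ) 1 : Set (ℝ × ℝ)).indicator fun p => f (p.1 / p.2)) :=
      (hf.comp (by fun_prop)).indicator (MeasurableSet.univ.prod measurableSet_Ioo)
    convert this using 1
    ext p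
    simp [indicator]
  have h1 : ∫⁻ z : EuclideanSpace ℝ (Fin (k + 1 + 1)),
      (Ioo (0 : ℝ) 1).indicator (fun s => f (inner ℝ z e / s)) ‖z‖
      = (∫⁻ η : sphere (0 : EuclideanSpace ℝ (Fin (k + 1 + 1))) 1,
          f (inner ℝ (η : EuclideanSpace ℝ (Fin (k + 1 + 1))) e)
        ∂(volume : Measure (EuclideanSpace ℝ (Fin (k + 1 + 1)))).toSphere) * c := by
    rw [lintegral_eq_lintegral_toSphere volume
      (f := fun z : EuclideanSpace ℝ (Fin (k + 1 + 1)) =>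
        (Ioo (0 : ℝ) 1).indicator (fun s => f (inner ℝ z e / s)) ‖z‖)
      (hF.comp (f := fun z : EuclideanSpace ℝ (Fin (k + 1 + 1)) => (inner ℝ z e, ‖z‖))
        (by fun_prop)),
      ← lintegral_mul_const' _ _ hct]
    refine lintegral_congr fun η => ?_
    have hη : ‖(η : EuclideanSpace ℝ (Fin (k + 1 + 1)))‖ = 1 := by simp
    have h : ∀ s ∈ Ioi (0 : ℝ),
        ENNReal.ofReal (s ^ (Module.finrank ℝ (EuclideanSpace ℝ (Fin (k + 1 + 1))) - 1))
          * (Ioo (0 : ℝ) 1).indicator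
            (fun t => f (inner ℝ (s • (η : EuclideanSpace ℝ (Fin (k + 1 + 1)))) e / t))
            ‖s • (η : EuclideanSpace ℝ (Fin (k + 1 + 1)))‖
        = (Ioo (0 : ℝ) 1).indicator (fun s => ENNReal.ofReal (s ^ (k + 1))
            * f (inner ℝ (η : EuclideanSpace ℝ (Fin (k + 1 + 1))) e)) s := fun s hs => by
      have hs0 : 0 < s := hs
      rw [norm_smul, hη, mul_one, Real.norm_eq_abs, abs_of_pos hs0]
      by_cases hm : s ∈ Ioo (0 : ℝ) 1
      · rw [indicator_of_mem hm, indicator_of_mem hm]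
        simp only [real_inner_smul_left, mul_div_cancel_left₀ _ hs0.ne', finrank_euclideanSpace_fin,
          Nat.add_sub_cancel]
      · rw [indicator_of_notMem hm, indicator_of_notMem hm, mul_zero]
    rw [setLIntegral_congr_fun measurableSet_Ioi h, lintegral_indicator measurableSet_Ioo,
      Measure.restrict_restrict measurableSet_Ioo, inter_eq_left.2 Ioo_subset_Ioi_self,
      lintegral_mul_const _ (by fun_prop), hc, mul_comm]
  have h1' : ∫⁻ z : EuclideanSpace ℝ (Fin (k + 1 + 1)),
      (Ioo (0 : ℝ) 1).indicator (fun s => f (inner ℝ z e / s)) ‖z‖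
      = ∫⁻ z : EuclideanSpace ℝ (Fin (k + 1 + 1)),
        (Ioo (0 : ℝ) 1).indicator (fun s => f (z 0 / s)) ‖z‖ := by
    obtain ⟨φ, hφ⟩ : ∃ φ : EuclideanSpace ℝ (Fin (k + 1 + 1)) ≃ₗᵢ[ℝ] EuclideanSpace ℝ (Fin (k + 1 + 1)),
        φ e = EuclideanSpace.single 0 1 :=
      ⟨_, Submodule.reflection_sub (v := e) (w := EuclideanSpace.single 0 1) (by simp [he])⟩
    rw [← φ.measurePreserving.lintegral_comp
      (f := fun z => (Ioo (0 : ℝ) 1).indicator (fun s => f (z 0 / s)) ‖z‖)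
      (hF.comp (f := fun z : EuclideanSpace ℝ (Fin (k + 1 + 1)) => (z 0, ‖z‖)) (by fun_prop))]
    refine lintegral_congr fun z => ?_
    rw [coord_eq_inner, ← hφ, φ.inner_map_map, φ.norm_map]
  have h2 : ∀ a : ℝ, ∫⁻ y : EuclideanSpace ℝ (Fin (k + 1)),
      (Ioo (0 : ℝ) 1).indicator (fun s => f (a / s)) √(a ^ 2 + ‖y‖ ^ 2)
      = (volume : Measure (EuclideanSpace ℝ (Fin (k + 1)))).toSphere univ *
        ∫⁻ b in Ioi (0 : ℝ), ENNReal.ofReal (b ^ k) *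
          (Ioo (0 : ℝ) 1).indicator (fun s => f (a / s)) √(a ^ 2 + b ^ 2) := fun a =>
    lintegral_comp_sqrt_norm
      (G := fun b => (Ioo (0 : ℝ) 1).indicator (fun s => f (a / s)) √(a ^ 2 + b ^ 2))
      (hF.comp (f := fun b : ℝ => (a, √(a ^ 2 + b ^ 2))) (by fun_prop))
  have hG : Measurable fun p : ℝ × ℝ => ENNReal.ofReal (p.2 ^ k) *
          (Ioo (0 : ℝ) 1).indicator (fun s => f (p.1 / s)) √(p.1 ^ 2 + p.2 ^ 2) :=
    Measurable.mul (by fun_prop)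
      (hF.comp (f := fun p : ℝ × ℝ => (p.1, √(p.1 ^ 2 + p.2 ^ 2))) (by fun_prop))
  have h3 := lintegral_upper_half_plane hG
  have h4 : ∀ s ∈ Ioi (0 : ℝ), ∫⁻ θ in Ioo 0 π, ENNReal.ofReal s *
        (ENNReal.ofReal ((s * Real.sin θ) ^ k) * (Ioo (0 : ℝ) 1).indicator
          (fun t => f (s * Real.cos θ / t)) √((s * Real.cos θ) ^ 2 + (s * Real.sin θ) ^ 2))
      = (Ioo (0 : ℝ) 1).indicator (fun s => ENNReal.ofReal (s ^ (k + 1)) *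
          ∫⁻ θ in Ioo 0 π, ENNReal.ofReal (Real.sin θ ^ k) * f (Real.cos θ)) s := fun s hs => by
    have hs0 : 0 < s := hs
    have hsq : ∀ θ, √((s * Real.cos θ) ^ 2 + (s * Real.sin θ) ^ 2) = s := fun θ => by
      rw [show (s * Real.cos θ) ^ 2 + (s * Real.sin θ) ^ 2
        = s ^ 2 * (Real.sin θ ^ 2 + Real.cos θ ^ 2) by ring, Real.sin_sq_add_cos_sq, mul_one,
        Real.sqrt_sq hs0.le]
    simp only [hsq]
    by_cases hm : s ∈ Ioo (0 : ℝ) 1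
    · simp only [indicator_of_mem hm]
      rw [← lintegral_const_mul' _ _ ENNReal.ofReal_ne_top]
      refine setLIntegral_congr_fun measurableSet_Ioo fun θ hθ => ?_
      rw [mul_div_cancel_left₀ _ hs0.ne', ← mul_assoc, ← mul_assoc, ← ENNReal.ofReal_mul hs0.le,
        ← ENNReal.ofReal_mul (by positivity)]
      congr 2
      ring
    · simp only [indicator_of_notMem hm, mul_zero, lintegral_zero]
  have h5 : (volume : Measure (EuclideanSpace ℝ (Fin (k + 1)))).toSphere univ ≠ ∞ :=
    measure_ne_top _ _
  rw [← ENNReal.mul_left_inj hc0 hct, ← h1, h1',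
    lintegral_coord_norm_eq (F := fun a b => (Ioo (0 : ℝ) 1).indicator (fun s => f (a / s)) b) hF]
  simp only [h2]
  rw [lintegral_const_mul' _ _ h5, h3, setLIntegral_congr_fun measurableSet_Ioi h4,
    lintegral_indicator measurableSet_Ioo,
      Measure.restrict_restrict measurableSet_Ioo, inter_eq_left.2 Ioo_subset_Ioi_self,
      lintegral_mul_const _ (by fun_prop), ← hc, lintegral_cos, mul_assoc, mul_comm c]
  congr 3
  push_cast
  ring_nf

end Slicing

section KernelIntegral

variable {m : ℕ}

local notation "𝔼₁" => EuclideanSpace ℝ (Fin (m + 1))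

lemma continuous_kernel_sphere {lam κ : ℝ} {x : 𝔼₁} (hx : ‖x‖ < 1) (l : 𝔼₁) :
    Continuous fun η : sphere (0 : 𝔼₁) 1 =>
      |inner ℝ ((η : 𝔼₁) - κ • x) l| * (‖x - η‖ ^ 2) ^ (-lam) := by
  refine Continuous.mul (by fun_prop) (Continuous.rpow_const (by fun_prop) fun η => Or.inl ?_)
  have hη : ‖(η : 𝔼₁)‖ = 1 := by simp
  have : x - (η : 𝔼₁) ≠ 0 := fun h => by
    rw [sub_eq_zero.1 h] at hx
    linarith
  positivity

lemma integral_kernel_sphere_le [NeZero m] {lam κ : ℝ} {x e : 𝔼₁} {r : ℝ}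
    (hd : 2 * lam + 2 = m + 1) (hlam : 0 < lam) (hκ : κ * (lam + 1) = lam) (hx : ‖x‖ < 1)
    (hxe : x = r • e) (he : ‖e‖ = 1) (l : 𝔼₁) :
    ∫ η : sphere (0 : 𝔼₁) 1, |inner ℝ ((η : 𝔼₁) - κ • x) l| * (‖x - η‖ ^ 2) ^ (-lam)
        ∂(volume : Measure 𝔼₁).toSphere
      ≤ ‖l‖ * ∫ η : sphere (0 : 𝔼₁) 1, |inner ℝ ((η : 𝔼₁) - κ • x) e| * (‖x - η‖ ^ 2) ^ (-lam)
        ∂(volume : Measure 𝔼₁).toSphere := by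
  have hnn : ∀ l : 𝔼₁, 0 ≤ᵐ[(volume : Measure 𝔼₁).toSphere] fun η : sphere (0 : 𝔼₁) 1 =>
      |inner ℝ ((η : 𝔼₁) - κ • x) l| * (‖x - η‖ ^ 2) ^ (-lam) := fun l =>
    Eventually.of_forall fun η => by positivity
  rcases eq_or_ne l 0 with rfl | hl
  · simp
  have hl0 : 0 < ‖l‖ := norm_pos_iff.2 hl
  have h1 : ∀ η : sphere (0 : 𝔼₁) 1, |inner ℝ ((η : 𝔼₁) - κ • x) l| * (‖x - η‖ ^ 2) ^ (-lam)
      = ‖l‖ * (|inner ℝ ((η : 𝔼₁) - κ • x) (‖l‖⁻¹ • l)| * (‖x - η‖ ^ 2) ^ (-lam)) := fun η => by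
    rw [real_inner_smul_right, abs_mul, abs_of_pos (inv_pos.2 hl0)]
    field_simp
  simp only [h1]
  rw [integral_const_mul]
  refine mul_le_mul_of_nonneg_left ?_ hl0.le
  rw [integral_eq_lintegral_of_nonneg_ae (hnn _) (continuous_kernel_sphere hx _).aestronglyMeasurable,
    integral_eq_lintegral_of_nonneg_ae (hnn _) (continuous_kernel_sphere hx _).aestronglyMeasurable]
  refine ENNReal.toReal_mono ?_ (lintegral_sphere_le (by simpa using hd) hlam hκ hx hxe he ?_)
  · have hi := (continuous_kernel_sphere (lam := lam) (κ := κ) hx e).integrable_of_hasCompactSupport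
      (μ := (volume : Measure 𝔼₁).toSphere) (HasCompactSupport.of_compactSpace _)
    exact hi.lintegral_lt_top.ne
  · rw [norm_smul, norm_inv, norm_norm, inv_mul_cancel₀ hl0.ne']

lemma integral_kernel_sphere_eq [NeZero m] {lam κ : ℝ} {x e : 𝔼₁} {r : ℝ}
    (hx : ‖x‖ < 1) (hxe : x = r • e) (he : ‖e‖ = 1) :
    ∫ η : sphere (0 : 𝔼₁) 1, |inner ℝ ((η : 𝔼₁) - κ • x) e| * (‖x - η‖ ^ 2) ^ (-lam)
        ∂(volume : Measure 𝔼₁).toSphere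
      = (volume : Measure (EuclideanSpace ℝ (Fin m))).toSphere.real univ
        * ∫ t in (-1 : ℝ)..1, |t - κ * r| * (1 - t ^ 2) ^ (((m : ℝ) - 2) / 2)
          / (1 - 2 * t * r + r ^ 2) ^ lam := by
  have h1 : ∀ η : sphere (0 : 𝔼₁) 1, |inner ℝ ((η : 𝔼₁) - κ • x) e| * (‖x - η‖ ^ 2) ^ (-lam)
      = |inner ℝ (η : 𝔼₁) e - κ * r| * (1 - 2 * inner ℝ (η : 𝔼₁) e * r + r ^ 2) ^ (-lam) :=
      fun η => by
    have hη : ‖(η : 𝔼₁)‖ = 1 := by simp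
    have h2 : ‖x - η‖ ^ 2 = 1 - 2 * inner ℝ (η : 𝔼₁) e * r + r ^ 2 := by
      rw [norm_sub_sq_real, hxe, norm_smul, he, hη, real_inner_smul_left, real_inner_comm,
        mul_one, Real.norm_eq_abs, sq_abs]
      ring
    rw [h2, hxe, inner_sub_left, smul_smul, real_inner_smul_left, real_inner_self_eq_norm_sq, he]
    simp
  have hbase : ∀ t ∈ Ioo (-1 : ℝ) 1, 0 < 1 - 2 * t * r + r ^ 2 := fun t ht => by
    nlinarith [sq_nonneg (r - t), ht.1, ht.2, mul_pos (sub_pos.2 ht.2) (neg_lt_iff_pos_add.1 ht.1)]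
  have hm : Measurable fun t : ℝ => ENNReal.ofReal
      (|t - κ * r| * (1 - 2 * t * r + r ^ 2) ^ (-lam)) := by fun_prop
  have h3 := lintegral_sphere_inner hm he
  rw [integral_eq_lintegral_of_nonneg_ae (Eventually.of_forall fun η => by positivity)
    (continuous_kernel_sphere hx _).aestronglyMeasurable]
  simp only [h1]
  rw [h3, ENNReal.toReal_mul, intervalIntegral.integral_of_le (by norm_num),
    integral_Ioc_eq_integral_Ioo, integral_eq_lintegral_of_nonneg_ae]
  · rw [measureReal_def]
    congr 2
    refine setLIntegral_congr_fun measurableSet_Ioo fun t ht => ?_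
    have h4 : 0 ≤ 1 - t ^ 2 := by nlinarith [ht.1, ht.2]
    rw [← ENNReal.ofReal_mul (by positivity), Real.rpow_neg (hbase t ht).le]
    congr 1
    ring
  · refine (ae_restrict_iff' measurableSet_Ioo).2 (Eventually.of_forall fun t ht => ?_)
    have h4 : 0 ≤ 1 - t ^ 2 := by nlinarith [ht.1, ht.2]
    have := hbase t ht
    simp only [Pi.zero_apply]
    positivity
  · exact Measurable.aestronglyMeasurable (by fun_prop)

lemma toSphere_real_univ_mul [NeZero m] :
    ((m + 1 : ℕ) : ℝ) * (volume : Measure (EuclideanSpace ℝ (Fin m))).toSphere.real univ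
      = 2 * Real.Gamma ((((m + 1 : ℕ) : ℝ) + 2) / 2)
          / (Real.Gamma (1 / 2) * Real.Gamma ((((m + 1 : ℕ) : ℝ) - 1) / 2))
        * (volume : Measure 𝔼₁).toSphere.real univ := by
  have hm : (0 : ℝ) < m := by exact_mod_cast Nat.pos_of_ne_zero (NeZero.ne m)
  rw [Measure.toSphere_real_apply_univ, Measure.toSphere_real_apply_univ, measureReal_def,
    measureReal_def, EuclideanSpace.volume_ball, EuclideanSpace.volume_ball]
  have h1 := Real.Gamma_pos_of_pos (show 0 < (m : ℝ) / 2 by positivity)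
  have h2 := Real.Gamma_pos_of_pos (show 0 < ((m + 1 : ℕ) : ℝ) / 2 + 1 by positivity)
  have h3 : Real.Gamma ((m : ℝ) / 2 + 1) = m / 2 * Real.Gamma (m / 2) :=
    Real.Gamma_add_one (by positivity)
  rw [show (((m + 1 : ℕ) : ℝ) + 2) / 2 = ((m + 1 : ℕ) : ℝ) / 2 + 1 by ring,
    show (((m + 1 : ℕ) : ℝ) - 1) / 2 = (m : ℝ) / 2 by push_cast; ring, Real.Gamma_one_half_eq]
  have h4 : 0 < √π := Real.sqrt_pos.2 Real.pi_pos
  simp only [ENNReal.ofReal_one, one_pow, one_mul, Fintype.card_fin, finrank_euclideanSpace_fin]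
  rw [ENNReal.toReal_ofReal (by rw [h3]; positivity), ENNReal.toReal_ofReal (by positivity), h3]
  generalize Real.Gamma (((m + 1 : ℕ) : ℝ) / 2 + 1) = a at *
  field_simp
  ring

end KernelIntegral

section GradientBound

variable {m : ℕ}

local notation "𝔼₁" => EuclideanSpace ℝ (Fin (m + 1))

lemma one_sub_mul_norm_fderiv_le [NeZero m] (hm : 2 ≤ m) {u : 𝔼₁ → ℝ} {R M : ℝ} (hR : 1 < R)
    (hu : ContDiffOn ℝ 2 u (ball 0 R)) (hl : ∀ z ∈ ball 0 R, coordLaplacian u z = 0)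
    (hM : ∀ y ∈ closedBall 0 1, |u y| ≤ M) {x : 𝔼₁} (hx : ‖x‖ < 1) :
    (1 - ‖x‖ ^ 2) * ‖fderiv ℝ u x‖
      ≤ 2 * Real.Gamma ((((m + 1 : ℕ) : ℝ) + 2) / 2)
          / (Real.Gamma (1 / 2) * Real.Gamma ((((m + 1 : ℕ) : ℝ) - 1) / 2))
        * (∫ t in (-1 : ℝ)..1, |t - (((m + 1 : ℕ) : ℝ) - 2) / ((m + 1 : ℕ) : ℝ) * ‖x‖|
            * (1 - t ^ 2) ^ ((((m + 1 : ℕ) : ℝ) - 3) / 2)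
            / (1 - 2 * t * ‖x‖ + ‖x‖ ^ 2) ^ ((((m + 1 : ℕ) : ℝ) - 2) / 2)) * M := by
  obtain ⟨e, he, hxe⟩ : ∃ e : 𝔼₁, ‖e‖ = 1 ∧ x = ‖x‖ • e := by
    rcases eq_or_ne x 0 with rfl | hx0
    · exact ⟨EuclideanSpace.single 0 1, by simp, by simp⟩
    · have := norm_ne_zero_iff.2 hx0
      exact ⟨‖x‖⁻¹ • x, by rw [norm_smul, norm_inv, norm_norm, inv_mul_cancel₀ this],
        (smul_inv_smul₀ this x).symm⟩
  have hM0 : 0 ≤ M := (abs_nonneg _).trans (hM 0 (by simp))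
  have hm' : (2 : ℝ) ≤ m := by exact_mod_cast hm
  obtain ⟨lam, hlam⟩ : ∃ lam, lam = (((m + 1 : ℕ) : ℝ) - 2) / 2 := ⟨_, rfl⟩
  obtain ⟨κ, hκ⟩ : ∃ κ, κ = (((m + 1 : ℕ) : ℝ) - 2) / ((m + 1 : ℕ) : ℝ) := ⟨_, rfl⟩
  have hlam0 : 0 < lam := by
    rw [hlam]
    push_cast
    linarith
  have hd : 2 * lam + 2 = m + 1 := by
    rw [hlam]
    push_cast
    ring
  have hκl : κ * (lam + 1) = lam := by
    rw [hκ, hlam]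
    push_cast
    field_simp
    ring
  have hS := toSphere_real_univ_mul (m := m)
  have hI := integral_kernel_sphere_eq (lam := lam) (κ := κ) hx hxe he
  have hN := integral_kernel_sphere_le hd hlam0 hκl hx hxe he
  rw [← hlam, ← hκ, show (((m + 1 : ℕ) : ℝ) - 3) / 2 = ((m : ℝ) - 2) / 2 by push_cast; ring]
  generalize 2 * Real.Gamma ((((m + 1 : ℕ) : ℝ) + 2) / 2)
          / (Real.Gamma (1 / 2) * Real.Gamma ((((m + 1 : ℕ) : ℝ) - 1) / 2)) = c at hS ⊢
  generalize (∫ t in (-1 : ℝ)..1, |t - κ * ‖x‖| * (1 - t ^ 2) ^ (((m : ℝ) - 2) / 2)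
    / (1 - 2 * t * ‖x‖ + ‖x‖ ^ 2) ^ lam) = J at hI ⊢
  have hσ : 0 < (volume : Measure 𝔼₁).toSphere.real univ := by
    rw [Measure.toSphere_real_apply_univ]
    refine mul_pos ?_ (ENNReal.toReal_pos (isOpen_ball.measure_pos _ (by simp)).ne' (by finiteness))
    simp
    positivity
  have hx2 : 0 < 1 - ‖x‖ ^ 2 := by nlinarith [norm_nonneg x]
  have hJ : 0 ≤ c * J * (volume : Measure 𝔼₁).toSphere.real univ := by
    rw [mul_right_comm, ← hS, mul_assoc, ← hI]
    exact mul_nonneg (Nat.cast_nonneg _)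
      (integral_nonneg fun η => mul_nonneg (abs_nonneg _) (Real.rpow_nonneg (sq_nonneg _) _))
  have hW : ContinuousOn (fun η : 𝔼₁ => (‖x - η‖ ^ 2) ^ (-lam)) (sphere 0 1) := by
    refine ContinuousOn.rpow_const (by fun_prop) fun η hη => Or.inl ?_
    have hη' : ‖η‖ = 1 := by simpa using hη
    have : x - η ≠ 0 := fun h => by
      rw [sub_eq_zero.1 h] at hx
      linarith
    positivity
  have key : ∀ l, (1 - ‖x‖ ^ 2) * fderiv ℝ u x l ≤ c * J * M * ‖l‖ := fun l => by
    obtain ⟨v, U, l', hU, hb, hv, hlv, hvM, hl', heq⟩ := exists_harmonic_recentred hR hu hl hM hx l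
    rw [← hlam] at hvM
    have h1 := sphere_mul_fderiv_sub_le hU hb hv hlv hW hvM x l'
    rw [heq, ← hκ] at h1
    have h2 := hN l'
    rw [hI, hl'] at h2
    have h3 : ((m + 1 : ℕ) : ℝ) * (M * ∫ η : sphere (0 : 𝔼₁) 1, |inner ℝ ((η : 𝔼₁) - κ • x) l'|
        * (‖x - η‖ ^ 2) ^ (-lam) ∂(volume : Measure 𝔼₁).toSphere)
        ≤ (volume : Measure 𝔼₁).toSphere.real univ * (c * J * M * ‖l‖) := by
      calc _ ≤ ((m + 1 : ℕ) : ℝ) * (M * (‖l‖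
            * ((volume : Measure (EuclideanSpace ℝ (Fin m))).toSphere.real univ * J))) := by gcongr
        _ = (((m + 1 : ℕ) : ℝ) * (volume : Measure (EuclideanSpace ℝ (Fin m))).toSphere.real univ)
            * (M * ‖l‖ * J) := by ring
        _ = _ := by
          rw [hS]
          ring
    exact le_of_mul_le_mul_left (h1.trans h3) hσ
  have hcJ : 0 ≤ c * J := nonneg_of_mul_nonneg_left hJ hσ
  rw [← le_div_iff₀' hx2]
  refine ContinuousLinearMap.opNorm_le_bound _ (by positivity) fun l => ?_
  rw [div_mul_eq_mul_div, le_div_iff₀' hx2, Real.norm_eq_abs]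
  have h1 := key l
  have h2 := key (-l)
  rw [map_neg, norm_neg] at h2
  rcases abs_cases (fderiv ℝ u x l) with h | h <;> rw [h.1] <;> linarith

end GradientBound

section Dilation

variable {n : ℕ}

local notation "𝔼" => EuclideanSpace ℝ (Fin n)

lemma coordLaplacian_comp_smul (k : ℝ) (u : 𝔼 → ℝ) (z : 𝔼) :
    coordLaplacian (fun y => u (k • y)) z = k ^ 2 * coordLaplacian u (k • z) := by
  have h : fderiv ℝ (fun y => u (k • y)) = k • fun y => fderiv ℝ u (k • y) := by
    ext1 y
    exact fderiv_comp_smul k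
  unfold coordLaplacian
  have h2 : fderiv ℝ (k • fun y => fderiv ℝ u (k • y)) z = k • k • fderiv ℝ (fderiv ℝ u) (k • z) := by
    rw [← fderiv_comp_smul (f := fderiv ℝ u) k]
    exact congrFun (fderiv_const_smul_field (F := 𝔼 →L[ℝ] ℝ) (f := fun y => fderiv ℝ u (k • y)) k) z
  rw [h, h2, Finset.mul_sum]
  refine Finset.sum_congr rfl fun i _ => ?_
  simp
  ring

end Dilation

theorem khavinson_gradient_estimate (n : ℕ) (hn : 3 ≤ n)
    (u : EuclideanSpace ℝ (Fin n) → ℝ) (hu : IsHarmonicOnBall n u)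
    (hb : ∃ M : ℝ, ∀ y ∈ Metric.ball (0 : EuclideanSpace ℝ (Fin n)) 1, |u y| ≤ M)
    (x : EuclideanSpace ℝ (Fin n)) (hx : x ∈ Metric.ball (0 : EuclideanSpace ℝ (Fin n)) 1) :
    ‖gradient u x‖
      ≤ (2 * Real.Gamma (((n:ℝ) + 2)/2) / (Real.Gamma (1/2) * Real.Gamma (((n:ℝ) - 1)/2)))
          / (1 - ‖x‖^2)
        * (∫ t in (-1:ℝ)..1,
            |t - ((n:ℝ) - 2)/(n:ℝ) * ‖x‖| * (1 - t^2) ^ (((n:ℝ) - 3)/2)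
              / (1 - 2*t*‖x‖ + ‖x‖^2) ^ (((n:ℝ) - 2)/2))
        * supAbs n u := by
  obtain ⟨m, rfl⟩ : ∃ m, n = m + 1 := ⟨n - 1, by omega⟩
  have : NeZero m := ⟨by omega⟩
  obtain ⟨huc, hul⟩ := hu
  obtain ⟨M, hM⟩ := hb
  have hx1 : ‖x‖ < 1 := by simpa using hx
  have hx2 : 0 < 1 - ‖x‖ ^ 2 := by nlinarith [norm_nonneg x]
  have hsup : ∀ y ∈ ball (0 : EuclideanSpace ℝ (Fin (m + 1))) 1, |u y| ≤ supAbs (m + 1) u :=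
    fun y hy => le_ciSup (f := fun y : ball (0 : EuclideanSpace ℝ (Fin (m + 1))) 1 => |u y.1|)
      ⟨M, by rintro _ ⟨z, rfl⟩; exact hM z z.2⟩ ⟨y, hy⟩
  have hlap : ∀ z ∈ ball (0 : EuclideanSpace ℝ (Fin (m + 1))) 1, coordLaplacian u z = 0 :=
    fun z hz => by
      rw [← hul z hz, coordLaplacian]
      simp [iteratedFDeriv_two_apply]
  have hgrad : ‖gradient u x‖ = ‖fderiv ℝ u x‖ := by
    rw [gradient, LinearIsometryEquiv.norm_map]
  have hcont : ContinuousAt (fun ρ : ℝ => (1 - ‖x‖ ^ 2) * (ρ * ‖fderiv ℝ u (ρ • x)‖)) 1 := by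
    have h1 : ContinuousAt (fderiv ℝ u) ((1 : ℝ) • x) := by
      rw [one_smul]
      exact (huc.continuousOn_fderiv_of_isOpen isOpen_ball (by norm_num)).continuousAt
        (isOpen_ball.mem_nhds hx)
    have h2 : ContinuousAt (fun ρ : ℝ => fderiv ℝ u (ρ • x)) 1 :=
      ContinuousAt.comp (f := fun ρ : ℝ => ρ • x) h1 (by fun_prop)
    fun_prop
  have hlim := hcont.tendsto.mono_left (nhdsWithin_le_nhds (s := Iio 1))
  rw [one_smul, one_mul] at hlim
  rw [hgrad, div_mul_eq_mul_div, div_mul_eq_mul_div, le_div_iff₀' hx2]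
  refine le_of_tendsto hlim (Filter.mem_of_superset (Ioo_mem_nhdsLT (zero_lt_one' ℝ)) fun ρ hρ => ?_)
  have hmaps : ∀ z ∈ ball (0 : EuclideanSpace ℝ (Fin (m + 1))) ρ⁻¹, ρ • z ∈ ball (0 :
      EuclideanSpace ℝ (Fin (m + 1))) 1 := fun z hz => by
    rw [mem_ball_zero_iff] at hz ⊢
    rw [norm_smul, Real.norm_eq_abs, abs_of_pos hρ.1]
    exact (lt_inv_mul_iff₀ hρ.1).1 (by rwa [mul_one])
  have hR : 1 < ρ⁻¹ := (one_lt_inv₀ hρ.1).2 hρ.2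
  have h := one_sub_mul_norm_fderiv_le (by omega) (u := fun y => u (ρ • y)) hR
    (huc.comp (by fun_prop) hmaps)
    (fun z hz => by rw [coordLaplacian_comp_smul, hlap _ (hmaps z hz), mul_zero])
    (fun y hy => hsup _ (hmaps y (closedBall_subset_ball hR hy))) hx1
  rw [fderiv_comp_smul, norm_smul, Real.norm_eq_abs, abs_of_pos hρ.1] at h
  exact h
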